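/- Assume in addition that Ω is bounded. Let u ∈ L^∞_loc(Ω) be a function which is nonnegative a.e. in Ω and is a supersolution of −Δu + |u|^{q−1}u = 0. Then there exists a solution w of the equation in Ω such that w ≤ u a.e. in Ω, and such that V ≤ w a.e. in Ω for every solution V of the equation satisfying V ≤ u a.e. in Ω; i.e., w is the maximal solution dominated by u. -/

import Mathlib

open MeasureTheory Set Filter

noncomputable section

def laplacian {N : ℕ} (φ : EuclideanSpace ℝ (Fin N) → ℝ) (x : EuclideanSpace ℝ (Fin N)) : ℝ :=
  ∑ i : Fin N, iteratedFDeriv ℝ 2 φ x ![EuclideanSpace.single i 1, EuclideanSpace.single i 1]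

def IsTestFun {N : ℕ} (Ω : Set (EuclideanSpace ℝ (Fin N))) (φ : EuclideanSpace ℝ (Fin N) → ℝ) : Prop :=
  ContDiff ℝ (⊤ : ℕ∞) φ ∧ HasCompactSupport φ ∧ tsupport φ ⊆ Ω

def MemLqLoc {N : ℕ} (q : ℝ) (Ω : Set (EuclideanSpace ℝ (Fin N)))
    (u : EuclideanSpace ℝ (Fin N) → ℝ) : Prop :=
  AEStronglyMeasurable u (volume.restrict Ω) ∧
  ∀ K : Set (EuclideanSpace ℝ (Fin N)), K ⊆ Ω → IsCompact K →
    IntegrableOn (fun x => |u x| ^ q) K volume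

def MemLinftyLoc {N : ℕ} (Ω : Set (EuclideanSpace ℝ (Fin N)))
    (u : EuclideanSpace ℝ (Fin N) → ℝ) : Prop :=
  AEStronglyMeasurable u (volume.restrict Ω) ∧
  ∀ K : Set (EuclideanSpace ℝ (Fin N)), K ⊆ Ω → IsCompact K →
    ∃ M : ℝ, ∀ᵐ x ∂(volume.restrict K), |u x| ≤ M

def IsSubsolution {N : ℕ} (q : ℝ) (Ω : Set (EuclideanSpace ℝ (Fin N)))
    (u : EuclideanSpace ℝ (Fin N) → ℝ) : Prop :=
  MemLqLoc q Ω u ∧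
  ∀ φ : EuclideanSpace ℝ (Fin N) → ℝ, IsTestFun Ω φ → (∀ x, 0 ≤ φ x) →
    (∫ x in Ω, (-(u x) * laplacian φ x + |u x| ^ (q - 1) * u x * φ x)) ≤ 0

def IsSupersolution {N : ℕ} (q : ℝ) (Ω : Set (EuclideanSpace ℝ (Fin N)))
    (u : EuclideanSpace ℝ (Fin N) → ℝ) : Prop :=
  MemLqLoc q Ω u ∧
  ∀ φ : EuclideanSpace ℝ (Fin N) → ℝ, IsTestFun Ω φ → (∀ x, 0 ≤ φ x) →
    0 ≤ (∫ x in Ω, (-(u x) * laplacian φ x + |u x| ^ (q - 1) * u x * φ x))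

def IsSolution {N : ℕ} (q : ℝ) (Ω : Set (EuclideanSpace ℝ (Fin N)))
    (u : EuclideanSpace ℝ (Fin N) → ℝ) : Prop :=
  MemLqLoc q Ω u ∧
  ∀ φ : EuclideanSpace ℝ (Fin N) → ℝ, IsTestFun Ω φ →
    (∫ x in Ω, (-(u x) * laplacian φ x + |u x| ^ (q - 1) * u x * φ x)) = 0

open scoped Topology Convolution ContDiff

/-- Euclidean space of dimension `N`. -/
abbrev Eu (N : ℕ) : Type := EuclideanSpace ℝ (Fin N)

/-- The `i`-th partial derivative. -/
def pd {N : ℕ} (i : Fin N) (φ : Eu N → ℝ) (x : Eu N) : ℝ :=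
  fderiv ℝ φ x (EuclideanSpace.single i 1)

theorem ContDiff.pd {N : ℕ} {φ : Eu N → ℝ} (h : ContDiff ℝ ∞ φ) (i : Fin N) :
    ContDiff ℝ ∞ (pd i φ) :=
  (h.fderiv_right (m := ∞) (by simp)).clm_apply contDiff_const

theorem tsupport_pd_subset {N : ℕ} (φ : Eu N → ℝ) (i : Fin N) : tsupport (pd i φ) ⊆ tsupport φ :=
  tsupport_fderiv_apply_subset ℝ _

theorem HasCompactSupport.pd {N : ℕ} {φ : Eu N → ℝ} (h : HasCompactSupport φ) (i : Fin N) :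
    HasCompactSupport (pd i φ) :=
  h.fderiv_apply ℝ _

theorem laplacian_eq_sum_pd {N : ℕ} {φ : Eu N → ℝ} (h : ContDiff ℝ ∞ φ) (x : Eu N) :
    laplacian φ x = ∑ i, pd i (pd i φ) x := by
  have h1 : Differentiable ℝ (fderiv ℝ φ) :=
    (h.fderiv_right (m := ∞) (by simp)).differentiable (by simp)
  refine Finset.sum_congr rfl fun i _ => ?_
  rw [iteratedFDeriv_two_apply]
  unfold _root_.pd
  rw [fderiv_clm_apply (h1 x) (differentiableAt_const _)]
  simp

theorem ContDiff.laplacian {N : ℕ} {φ : Eu N → ℝ} (h : ContDiff ℝ ∞ φ) :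
    ContDiff ℝ ∞ (laplacian φ) := by
  rw [funext (laplacian_eq_sum_pd h)]
  exact ContDiff.sum fun i _ => (h.pd i).pd i

theorem tsupport_laplacian_subset {N : ℕ} {φ : Eu N → ℝ} (h : ContDiff ℝ ∞ φ) :
    tsupport (laplacian φ) ⊆ tsupport φ := by
  refine closure_minimal (fun x hx => ?_) (isClosed_tsupport _)
  by_contra hn
  apply hx
  rw [laplacian_eq_sum_pd h]
  refine Finset.sum_eq_zero fun i _ => image_eq_zero_of_notMem_tsupport fun h2 => hn ?_
  exact tsupport_pd_subset _ _ (tsupport_pd_subset _ _ h2)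

theorem HasCompactSupport.laplacian {N : ℕ} {φ : Eu N → ℝ} (hc : HasCompactSupport φ)
    (h : ContDiff ℝ ∞ φ) : HasCompactSupport (laplacian φ) :=
  hc.of_isClosed_subset (isClosed_tsupport _) (tsupport_laplacian_subset h)

theorem pd_add {N : ℕ} {φ ψ : Eu N → ℝ} (h : ContDiff ℝ ∞ φ) (h' : ContDiff ℝ ∞ ψ) (i : Fin N) :
    pd i (fun x => φ x + ψ x) = fun x => pd i φ x + pd i ψ x := by
  funext x
  unfold pd
  rw [fderiv_fun_add (h.differentiable (by simp) x) (h'.differentiable (by simp) x)]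
  rfl

theorem pd_const_mul {N : ℕ} {φ : Eu N → ℝ} (h : ContDiff ℝ ∞ φ) (c : ℝ) (i : Fin N) :
    pd i (fun x => c * φ x) = fun x => c * pd i φ x := by
  funext x
  unfold pd
  rw [fderiv_const_mul (h.differentiable (by simp) x)]
  rfl

theorem laplacian_add {N : ℕ} {φ ψ : Eu N → ℝ} (h : ContDiff ℝ ∞ φ) (h' : ContDiff ℝ ∞ ψ)
    (x : Eu N) : laplacian (fun x => φ x + ψ x) x = laplacian φ x + laplacian ψ x := by
  rw [laplacian_eq_sum_pd (h.add h'), laplacian_eq_sum_pd h, laplacian_eq_sum_pd h',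
    ← Finset.sum_add_distrib]
  refine Finset.sum_congr rfl fun i _ => ?_
  rw [pd_add h h', pd_add (h.pd i) (h'.pd i)]

theorem laplacian_const_mul {N : ℕ} {φ : Eu N → ℝ} (h : ContDiff ℝ ∞ φ) (c : ℝ) (x : Eu N) :
    laplacian (fun x => c * φ x) x = c * laplacian φ x := by
  rw [laplacian_eq_sum_pd (contDiff_const.mul h), laplacian_eq_sum_pd h, Finset.mul_sum]
  refine Finset.sum_congr rfl fun i _ => ?_
  rw [pd_const_mul h, pd_const_mul (h.pd i)]

theorem laplacian_sub {N : ℕ} {φ ψ : Eu N → ℝ} (h : ContDiff ℝ ∞ φ) (h' : ContDiff ℝ ∞ ψ)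
    (x : Eu N) : laplacian (fun x => φ x - ψ x) x = laplacian φ x - laplacian ψ x := by
  have := laplacian_add h (contDiff_const.mul h' : ContDiff ℝ ∞ fun x => (-1) * ψ x) x
  rw [laplacian_const_mul h'] at this
  simpa [sub_eq_add_neg] using this

theorem integral_mul_pd {N : ℕ} {F φ : Eu N → ℝ} (hF : ContDiff ℝ ∞ F) (h : ContDiff ℝ ∞ φ)
    (hc : HasCompactSupport φ) (i : Fin N) :
    ∫ x, F x * pd i φ x = -∫ x, pd i F x * φ x := by
  refine integral_mul_fderiv_eq_neg_fderiv_mul_of_integrable ?_ ?_ ?_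
    (fun x _ => hF.differentiable (by simp) x) (fun x _ => h.differentiable (by simp) x)
  · exact ((hF.pd i).continuous.mul h.continuous).integrable_of_hasCompactSupport hc.mul_left
  · exact (hF.continuous.mul (h.pd i).continuous).integrable_of_hasCompactSupport (hc.pd i).mul_left
  · exact (hF.continuous.mul h.continuous).integrable_of_hasCompactSupport hc.mul_left

theorem integral_mul_laplacian {N : ℕ} {F φ : Eu N → ℝ} (hF : ContDiff ℝ ∞ F)
    (h : ContDiff ℝ ∞ φ) (hc : HasCompactSupport φ) :
    ∫ x, F x * laplacian φ x = ∫ x, laplacian F x * φ x := by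
  simp_rw [laplacian_eq_sum_pd h, laplacian_eq_sum_pd hF, Finset.mul_sum, Finset.sum_mul]
  rw [integral_finsetSum, integral_finsetSum]
  · refine Finset.sum_congr rfl fun i _ => ?_
    rw [integral_mul_pd hF (h.pd i) (hc.pd i)]
    have := integral_mul_pd (hF.pd i) h hc i
    linarith
  · exact fun i _ => (((hF.pd i).pd i).continuous.mul h.continuous).integrable_of_hasCompactSupport
      hc.mul_left
  · exact fun i _ => (hF.continuous.mul ((h.pd i).pd i).continuous).integrable_of_hasCompactSupport
      ((hc.pd i).pd i).mul_left

theorem laplacian_comp_ge {N : ℕ} {s : Eu N → ℝ} (hs : ContDiff ℝ ∞ s) {Φ Φ' Φ'' : ℝ → ℝ}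
    (hΦ : ContDiff ℝ ∞ Φ) (h1 : ∀ t, HasDerivAt Φ (Φ' t) t) (h2 : ∀ t, HasDerivAt Φ' (Φ'' t) t)
    (h3 : ∀ t, 0 ≤ Φ'' t) (x : Eu N) :
    Φ' (s x) * laplacian s x ≤ laplacian (fun x => Φ (s x)) x := by
  have hd : Differentiable ℝ s := hs.differentiable (by simp)
  rw [laplacian_eq_sum_pd (φ := fun x => Φ (s x)) (hΦ.comp hs), laplacian_eq_sum_pd hs, Finset.mul_sum]
  refine Finset.sum_le_sum fun i _ => ?_
  have e1 : pd i (fun x => Φ (s x)) = fun x => Φ' (s x) * pd i s x := by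
    funext y
    have := ((h1 (s y)).comp_hasFDerivAt y (hd y).hasFDerivAt).fderiv
    unfold pd
    simp only [Function.comp_def] at this
    rw [this]
    simp
  have e2 : pd i (fun x => Φ' (s x) * pd i s x) x =
      Φ' (s x) * pd i (pd i s) x + Φ'' (s x) * pd i s x * pd i s x := by
    have a := (h2 (s x)).comp_hasFDerivAt x (hd x).hasFDerivAt
    have b := ((hs.pd i).differentiable (by simp) x).hasFDerivAt
    have := (a.mul b).fderiv
    simp only [Function.comp_def] at this
    have t : fderiv ℝ (fun x => Φ' (s x) * pd i s x) x = _ := this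
    change fderiv ℝ (fun x => Φ' (s x) * pd i s x) x _ = _
    rw [t]
    simp only [pd, add_apply, smul_apply, smul_eq_mul]
    ring
  rw [e1, e2]
  nlinarith [h3 (s x), mul_nonneg (h3 (s x)) (mul_self_nonneg (pd i s x))]

theorem laplacian_comp_const_add {N : ℕ} {φ : Eu N → ℝ} (h : ContDiff ℝ ∞ φ) (a x : Eu N) :
    laplacian (fun y => φ (a + y)) x = laplacian φ (a + x) := by
  have hp : ∀ (ψ : Eu N → ℝ) (i : Fin N), pd i (fun y => ψ (a + y)) = fun y => pd i ψ (a + y) := by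
    intro ψ i
    funext y
    unfold pd
    rw [fderiv_comp_add_left]
  rw [laplacian_eq_sum_pd (φ := fun y => φ (a + y)) (h.comp (contDiff_const.add contDiff_id)),
    laplacian_eq_sum_pd h]
  simp only [hp]

theorem laplacian_comp_sub {N : ℕ} {φ : Eu N → ℝ} (h : ContDiff ℝ ∞ φ) (a x : Eu N) :
    laplacian (fun y => φ (a - y)) x = laplacian φ (a - x) := by
  have hp : ∀ (ψ : Eu N → ℝ), ContDiff ℝ ∞ ψ → ∀ i : Fin N,
      pd i (fun y => ψ (a - y)) = fun y => -pd i ψ (a - y) := by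
    intro ψ hψ i
    funext y
    unfold pd
    have := ((hψ.differentiable (by simp) (a - y)).hasFDerivAt.comp y
      ((hasFDerivAt_id y).const_sub a)).fderiv
    simp only [Function.comp_def] at this
    rw [this]
    simp
  rw [laplacian_eq_sum_pd (φ := fun y => φ (a - y)) (h.comp (contDiff_const.sub contDiff_id)),
    laplacian_eq_sum_pd h]
  refine Finset.sum_congr rfl fun i _ => ?_
  rw [hp φ h]
  have : (fun y => -pd i φ (a - y)) = fun y => (-1) * pd i φ (a - y) := by
    funext y; ring
  rw [this, pd_const_mul (φ := fun y => pd i φ (a - y))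
    ((h.pd i).comp (contDiff_const.sub contDiff_id)), hp _ (h.pd i)]
  ring

/-- A bump function supported in the ball of radius `1 / (n + 1)`. -/
def stdBump (N n : ℕ) : ContDiffBump (0 : Eu N) where
  rIn := 1 / (2 * ((n : ℝ) + 1))
  rOut := 1 / ((n : ℝ) + 1)
  rIn_pos := by positivity
  rIn_lt_rOut := by
    apply one_div_lt_one_div_of_lt <;> nlinarith [Nat.cast_nonneg (α := ℝ) n]


/-- The kernel of the standard mollifier. -/
def mker (N n : ℕ) : Eu N → ℝ := (stdBump N n).normed volume

/-- Mollification of a function. -/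
def moll {N : ℕ} (n : ℕ) (g : Eu N → ℝ) : Eu N → ℝ :=
  mker N n ⋆[ContinuousLinearMap.lsmul ℝ ℝ, volume] g

theorem contDiff_mker (N n : ℕ) : ContDiff ℝ ∞ (mker N n) := (stdBump N n).contDiff_normed

theorem hasCompactSupport_mker (N n : ℕ) : HasCompactSupport (mker N n) :=
  (stdBump N n).hasCompactSupport_normed

theorem mker_nonneg (N n : ℕ) (x : Eu N) : 0 ≤ mker N n x := (stdBump N n).nonneg_normed x

theorem integral_mker (N n : ℕ) : ∫ x, mker N n x = 1 := (stdBump N n).integral_normed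

theorem tsupport_mker (N n : ℕ) : tsupport (mker N n) = Metric.closedBall 0 (1 / ((n : ℝ) + 1)) :=
  (stdBump N n).tsupport_normed_eq

theorem convolution_lsmul_apply {N : ℕ} (φ g : Eu N → ℝ) (x : Eu N) :
    (φ ⋆[ContinuousLinearMap.lsmul ℝ ℝ, volume] g) x = ∫ y, φ (x - y) * g y := by
  rw [convolution_eq_swap]
  simp

theorem moll_apply {N : ℕ} (n : ℕ) (g : Eu N → ℝ) (x : Eu N) :
    moll n g x = ∫ y, mker N n (x - y) * g y := convolution_lsmul_apply _ _ _

theorem integrable_mul_comp_sub {N : ℕ} {φ g : Eu N → ℝ} (h : Continuous φ)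
    (hc : HasCompactSupport φ) (hg : Integrable g) (x : Eu N) :
    Integrable (fun y => φ (x - y) * g y) := by
  obtain ⟨C, hC⟩ := hc.exists_bound_of_continuous h
  exact hg.bdd_mul (c := C) (by fun_prop) (ae_of_all _ fun y => hC _)

theorem pd_convolution {N : ℕ} {φ g : Eu N → ℝ} (h : ContDiff ℝ ∞ φ) (hc : HasCompactSupport φ)
    (hg : Integrable g) (i : Fin N) :
    pd i (φ ⋆[ContinuousLinearMap.lsmul ℝ ℝ, volume] g) =
      (pd i φ ⋆[ContinuousLinearMap.lsmul ℝ ℝ, volume] g) := by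
  funext x
  have := (hc.hasFDerivAt_convolution_left (ContinuousLinearMap.lsmul ℝ ℝ)
    (h.of_le (by simp)) hg.locallyIntegrable x).fderiv
  unfold pd
  rw [this, convolution_eq_swap, ContinuousLinearMap.integral_apply, convolution_eq_swap]
  · rfl
  · have h2 : Continuous (fderiv ℝ φ) := h.continuous_fderiv (by simp)
    have := (hc.fderiv (𝕜 := ℝ)).convolutionExists_left
      (ContinuousLinearMap.precompL (Eu N) (ContinuousLinearMap.lsmul ℝ ℝ)) h2
      hg.locallyIntegrable x
    exact this.integrable_swap

theorem contDiff_moll {N : ℕ} (n : ℕ) {g : Eu N → ℝ} (hg : Integrable g) :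
    ContDiff ℝ ∞ (moll n g) :=
  (hasCompactSupport_mker N n).contDiff_convolution_left _ (contDiff_mker N n)
    hg.locallyIntegrable

theorem laplacian_moll {N : ℕ} (n : ℕ) {g : Eu N → ℝ} (hg : Integrable g) (x : Eu N) :
    laplacian (moll n g) x = ∫ y, laplacian (mker N n) (x - y) * g y := by
  have h := contDiff_mker N n
  have hc := hasCompactSupport_mker N n
  rw [laplacian_eq_sum_pd (contDiff_moll n hg)]
  simp_rw [laplacian_eq_sum_pd h, Finset.sum_mul]
  rw [integral_finsetSum]
  · refine Finset.sum_congr rfl fun i _ => ?_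
    unfold moll
    rw [pd_convolution h hc hg, pd_convolution (h.pd i) (hc.pd i) hg, convolution_lsmul_apply]
  · exact fun i _ => integrable_mul_comp_sub ((h.pd i).pd i).continuous ((hc.pd i).pd i) hg x

theorem integrable_moll {N : ℕ} (n : ℕ) {g : Eu N → ℝ} (hg : Integrable g) :
    Integrable (moll n g) :=
  ((contDiff_mker N n).continuous.integrable_of_hasCompactSupport
    (hasCompactSupport_mker N n)).integrable_convolution _ hg

theorem integral_moll {N : ℕ} (n : ℕ) {g : Eu N → ℝ} (hg : Integrable g) :
    ∫ x, moll n g x = ∫ x, g x := by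
  unfold moll
  rw [integral_convolution _ ((contDiff_mker N n).continuous.integrable_of_hasCompactSupport
    (hasCompactSupport_mker N n)) hg, integral_mker]
  simp

theorem moll_ae_tendsto {N : ℕ} {g : Eu N → ℝ} (hg : Integrable g) :
    ∀ᵐ x, Tendsto (fun n => moll n g x) atTop (𝓝 (g x)) := by
  refine ContDiffBump.ae_convolution_tendsto_right_of_locallyIntegrable (K := 2)
    (φ := fun n => stdBump N n) ?_ (Eventually.of_forall fun n => ?_) hg.locallyIntegrable
  · exact tendsto_one_div_add_atTop_nhds_zero_nat
  · apply le_of_eq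
    change 1 / ((n : ℝ) + 1) = 2 * (1 / (2 * ((n : ℝ) + 1)))
    field_simp

theorem moll_nonneg {N : ℕ} (n : ℕ) {g : Eu N → ℝ} (hg : ∀ x, 0 ≤ g x) (x : Eu N) :
    0 ≤ moll n g x := by
  rw [moll_apply]
  exact integral_nonneg fun y => mul_nonneg (mker_nonneg _ _ _) (hg y)

theorem moll_le {N : ℕ} (n : ℕ) {g : Eu N → ℝ} (hi : Integrable g) {M : ℝ}
    (hg : ∀ᵐ x, g x ≤ M) (x : Eu N) :
    moll n g x ≤ M := by
  have hk := (contDiff_mker N n).continuous.integrable_of_hasCompactSupport (μ := volume)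
    (hasCompactSupport_mker N n)
  have : ∫ y, mker N n (x - y) * M = M := by
    rw [integral_mul_const, integral_sub_left_eq_self (mker N n) volume x, integral_mker, one_mul]
  rw [moll_apply, ← this]
  refine integral_mono_ae (integrable_mul_comp_sub (contDiff_mker N n).continuous
    (hasCompactSupport_mker N n) hi x) ((hk.comp_sub_left x).mul_const M) ?_
  filter_upwards [hg] with y hy using mul_le_mul_of_nonneg_left hy (mker_nonneg _ _ _)

theorem moll_L1_of_nonneg {N : ℕ} {g : Eu N → ℝ} (hg : Integrable g) (h0 : ∀ x, 0 ≤ g x) :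
    Tendsto (fun n => ∫ x, |moll n g x - g x|) atTop (𝓝 0) := by
  have e : ∀ n, ∫ x, |moll n g x - g x| = 2 * ∫ x, max (g x - moll n g x) 0 := by
    intro n
    have i1 : Integrable fun x => moll n g x - g x := (integrable_moll n hg).sub hg
    have i2 : Integrable fun x => max (g x - moll n g x) 0 :=
      (hg.sub (integrable_moll n hg)).pos_part
    have : ∫ x, (moll n g x - g x) = 0 := by
      rw [integral_sub (integrable_moll n hg) hg, integral_moll n hg, sub_self]
    have h := integral_sub i1.abs (i2.const_mul 2)
    rw [integral_const_mul] at h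
    have h' : ∫ x, (|moll n g x - g x| - 2 * max (g x - moll n g x) 0) = 0 := by
      refine Eq.trans ?_ this
      refine integral_congr_ae (ae_of_all _ fun x => ?_)
      dsimp only
      rcases le_total (moll n g x) (g x) with h | h
      · rw [max_eq_left (by linarith), abs_of_nonpos (by linarith)]; ring
      · rw [max_eq_right (by linarith), abs_of_nonneg (by linarith)]; ring
    linarith
  simp_rw [e]
  have : Tendsto (fun n => ∫ x, max (g x - moll n g x) 0) atTop (𝓝 (∫ _ : Eu N, (0 : ℝ))) := by
    refine tendsto_integral_of_dominated_convergence g (fun n => ?_) hg (fun n => ?_) ?_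
    · exact (hg.sub (integrable_moll n hg)).pos_part.aestronglyMeasurable
    · refine ae_of_all _ fun x => ?_
      have := moll_nonneg n h0 x
      rw [Real.norm_eq_abs, abs_of_nonneg (le_max_right _ _)]
      exact max_le (by linarith) (h0 x)
    · filter_upwards [moll_ae_tendsto hg] with x hx
      have := (tendsto_const_nhds (x := g x)).sub hx
      simpa using this.max (tendsto_const_nhds (x := (0 : ℝ)))
  simpa using this.const_mul 2

theorem moll_sub {N : ℕ} (n : ℕ) {g h : Eu N → ℝ} (hg : Integrable g) (hh : Integrable h)
    (x : Eu N) : moll n (fun x => g x - h x) x = moll n g x - moll n h x := by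
  simp_rw [moll_apply, mul_sub]
  exact integral_sub (integrable_mul_comp_sub (contDiff_mker N n).continuous
    (hasCompactSupport_mker N n) hg x) (integrable_mul_comp_sub (contDiff_mker N n).continuous
    (hasCompactSupport_mker N n) hh x)

theorem moll_L1_tendsto {N : ℕ} {g : Eu N → ℝ} (hg : Integrable g) :
    Tendsto (fun n => ∫ x, |moll n g x - g x|) atTop (𝓝 0) := by
  have h1 : Integrable fun x => max (g x) 0 := hg.pos_part
  have h2 : Integrable fun x => max (-g x) 0 := hg.neg.pos_part
  have t := (moll_L1_of_nonneg h1 fun x => le_max_right _ _).add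
    (moll_L1_of_nonneg h2 fun x => le_max_right _ _)
  rw [add_zero] at t
  refine squeeze_zero (fun n => integral_nonneg fun x => abs_nonneg _) (fun n => ?_) t
  have e : g = fun x => max (g x) 0 - max (-g x) 0 := by
    funext x
    rcases le_total (g x) 0 with h | h
    · rw [max_eq_right h, max_eq_left (by linarith)]; ring
    · rw [max_eq_left h, max_eq_right (by linarith)]; ring
  have j1 := ((integrable_moll n h1).sub h1).abs
  have j2 := ((integrable_moll n h2).sub h2).abs
  refine (integral_mono ((integrable_moll n hg).sub hg).abs (j1.add j2) fun x => ?_).trans_eq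
    (integral_add j1 j2)
  have e1 : moll n g x = moll n (fun x => max (g x) 0) x - moll n (fun x => max (-g x) 0) x := by
    rw [← moll_sub n h1 h2, ← e]
  have e2 := congrFun e x
  simp only [Pi.sub_apply, Pi.add_apply]
  rw [e1]
  calc _ = |(moll n (fun x => max (g x) 0) x - max (g x) 0) -
        (moll n (fun x => max (-g x) 0) x - max (-g x) 0)| := by
        congr 1; linarith
    _ ≤ _ := abs_sub _ _

/-- The distributional inequality `f ≤ Δ v` in `Ω` for locally integrable functions. -/
def LapGE {N : ℕ} (Ω : Set (Eu N)) (v f : Eu N → ℝ) : Prop :=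
  LocallyIntegrableOn v Ω ∧ LocallyIntegrableOn f Ω ∧
    ∀ φ : Eu N → ℝ, IsTestFun Ω φ → (∀ x, 0 ≤ φ x) → ∫ x, f x * φ x ≤ ∫ x, v x * laplacian φ x

theorem IsTestFun.tsupport_laplacian {N : ℕ} {Ω : Set (Eu N)} {φ : Eu N → ℝ}
    (h : IsTestFun Ω φ) : tsupport (laplacian φ) ⊆ Ω :=
  (tsupport_laplacian_subset h.1).trans h.2.2

theorem integrable_mul_of_tsupport_subset {N : ℕ} {Ω : Set (Eu N)} {v ψ : Eu N → ℝ}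
    (hv : LocallyIntegrableOn v Ω) (h : Continuous ψ) (hc : HasCompactSupport ψ)
    (hs : tsupport ψ ⊆ Ω) : Integrable (fun x => v x * ψ x) := by
  have h1 : IntegrableOn v (tsupport ψ) := hv.integrableOn_compact_subset hs hc
  have h2 : IntegrableOn (fun x => v x * ψ x) (tsupport ψ) :=
    h1.mul_continuousOn h.continuousOn hc
  refine (integrableOn_iff_integrable_of_support_subset ?_).1 h2
  intro x hx
  exact subset_tsupport _ (right_ne_zero_of_mul hx)

theorem IsTestFun.integrable_mul {N : ℕ} {Ω : Set (Eu N)} {v φ : Eu N → ℝ}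
    (h : IsTestFun Ω φ) (hv : LocallyIntegrableOn v Ω) : Integrable (fun x => v x * φ x) :=
  integrable_mul_of_tsupport_subset hv h.1.continuous h.2.1 h.2.2

theorem IsTestFun.integrable_mul_laplacian {N : ℕ} {Ω : Set (Eu N)} {v φ : Eu N → ℝ}
    (h : IsTestFun Ω φ) (hv : LocallyIntegrableOn v Ω) :
    Integrable (fun x => v x * laplacian φ x) :=
  integrable_mul_of_tsupport_subset hv h.1.laplacian.continuous (h.2.1.laplacian h.1)
    h.tsupport_laplacian

theorem LapGE.add {N : ℕ} {Ω : Set (Eu N)} {v₁ v₂ f₁ f₂ : Eu N → ℝ} (h₁ : LapGE Ω v₁ f₁)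
    (h₂ : LapGE Ω v₂ f₂) : LapGE Ω (fun x => v₁ x + v₂ x) (fun x => f₁ x + f₂ x) := by
  refine ⟨h₁.1.add h₂.1, h₁.2.1.add h₂.2.1, fun φ hφ h0 => ?_⟩
  simp_rw [add_mul]
  rw [integral_add (hφ.integrable_mul h₁.2.1) (hφ.integrable_mul h₂.2.1),
    integral_add (hφ.integrable_mul_laplacian h₁.1) (hφ.integrable_mul_laplacian h₂.1)]
  exact add_le_add (h₁.2.2 φ hφ h0) (h₂.2.2 φ hφ h0)

theorem lapGE_zero {N : ℕ} (Ω : Set (Eu N)) : LapGE Ω (fun _ => 0) (fun _ => 0) := by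
  refine ⟨locallyIntegrableOn_zero, locallyIntegrableOn_zero, fun φ _ _ => ?_⟩
  simp

theorem LapGE.le_laplacian_moll {N : ℕ} {Ω K : Set (Eu N)} {v f : Eu N → ℝ} (h : LapGE Ω v f)
    (hK : IsCompact K) (hKΩ : K ⊆ Ω) {n : ℕ} {x : Eu N}
    (hx : Metric.closedBall x (1 / ((n : ℝ) + 1)) ⊆ K) :
    moll n (K.indicator f) x ≤ laplacian (moll n (K.indicator v)) x := by
  have iv : Integrable (K.indicator v) :=
    (integrable_indicator_iff hK.measurableSet).2 (h.1.integrableOn_compact_subset hKΩ hK)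
  have hs : tsupport (fun y => mker N n (x - y)) ⊆ K := by
    refine (closure_minimal (fun y hy => ?_) Metric.isClosed_closedBall).trans hx
    have : x - y ∈ tsupport (mker N n) := subset_tsupport (mker N n) hy
    rw [tsupport_mker, mem_closedBall_zero_iff] at this
    rwa [Metric.mem_closedBall, dist_comm, dist_eq_norm]
  have ht : IsTestFun Ω (fun y => mker N n (x - y)) := by
    refine ⟨(contDiff_mker N n).comp (contDiff_const.sub contDiff_id), ?_, hs.trans hKΩ⟩
    exact hK.of_isClosed_subset (isClosed_tsupport _) hs
  have key := h.2.2 _ ht fun y => mker_nonneg _ _ _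
  rw [moll_apply, laplacian_moll n iv]
  convert key using 2
  · funext y
    by_cases hy : y ∈ K
    · simp [hy, mul_comm]
    · have : mker N n (x - y) = 0 :=
        image_eq_zero_of_notMem_tsupport (f := fun y => mker N n (x - y)) fun h => hy (hs h)
      simp [this]
  · funext y
    rw [laplacian_comp_sub (contDiff_mker N n)]
    by_cases hy : y ∈ K
    · simp [hy, mul_comm]
    · have : laplacian (fun y => mker N n (x - y)) y = 0 :=
        image_eq_zero_of_notMem_tsupport fun h => hy (hs (tsupport_laplacian_subset ht.1 h))
      rw [laplacian_comp_sub (contDiff_mker N n)] at this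
      simp [this]

theorem tendsto_integral_mul_of_L1 {N : ℕ} {A : ℕ → Eu N → ℝ} {a : Eu N → ℝ} {ψ : ℕ → Eu N → ℝ}
    {b : Eu N → ℝ} {C : ℝ} (hA : ∀ n, Integrable (A n)) (ha : Integrable a)
    (hL : Tendsto (fun n => ∫ x, |A n x - a x|) atTop (𝓝 0))
    (hm : ∀ n, AEStronglyMeasurable (ψ n)) (hb : ∀ n x, |ψ n x| ≤ C)
    (ht : ∀ᵐ x, Tendsto (fun n => ψ n x) atTop (𝓝 (b x))) :
    Tendsto (fun n => ∫ x, A n x * ψ n x) atTop (𝓝 (∫ x, a x * b x)) := by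
  have hi : ∀ (g : Eu N → ℝ), Integrable g → ∀ n, Integrable (fun x => g x * ψ n x) :=
    fun g hg n => hg.mul_bdd (c := C) (hm n) (ae_of_all _ fun x => hb n x)
  have h1 : Tendsto (fun n => ∫ x, a x * ψ n x) atTop (𝓝 (∫ x, a x * b x)) := by
    refine tendsto_integral_of_dominated_convergence (fun x => |a x| * C)
      (fun n => (hi a ha n).aestronglyMeasurable) (ha.abs.mul_const C) (fun n => ?_) ?_
    · refine ae_of_all _ fun x => ?_
      rw [norm_mul]
      exact mul_le_mul_of_nonneg_left (hb n x) (abs_nonneg _)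
    · filter_upwards [ht] with x hx using hx.const_mul _
  have h2 : Tendsto (fun n => ∫ x, (A n x - a x) * ψ n x) atTop (𝓝 0) := by
    have := hL.mul_const C
    rw [zero_mul] at this
    refine squeeze_zero_norm (fun n => ?_) this
    rw [← integral_mul_const]
    refine norm_integral_le_of_norm_le (((hA n).sub ha).abs.mul_const C) (ae_of_all _ fun x => ?_)
    rw [norm_mul]
    exact mul_le_mul_of_nonneg_left (hb n x) (abs_nonneg _)
  have h3 := h2.add h1
  rw [zero_add] at h3
  refine h3.congr fun n => ?_
  rw [← integral_add (hi (fun x => A n x - a x) ((hA n).sub ha) n) (hi a ha n)]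
  refine integral_congr_ae (ae_of_all _ fun x => ?_)
  dsimp only
  ring

/-- The derivative of `t ↦ √(t ^ 2 + δ)`. -/
def sgnApprox (δ t : ℝ) : ℝ := t / √(t ^ 2 + δ)

theorem abs_sgnApprox_le {δ : ℝ} (hδ : 0 < δ) (t : ℝ) : |sgnApprox δ t| ≤ 1 := by
  have h : 0 < √(t ^ 2 + δ) := Real.sqrt_pos.2 (by positivity)
  rw [sgnApprox, abs_div, abs_of_pos h, div_le_one h]
  exact Real.abs_le_sqrt (by linarith)

theorem hasDerivAt_sqrt_sq_add {δ : ℝ} (hδ : 0 < δ) (t : ℝ) :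
    HasDerivAt (fun t => √(t ^ 2 + δ)) (sgnApprox δ t) t := by
  have h0 : t ^ 2 + δ ≠ 0 := by positivity
  convert ((hasDerivAt_pow 2 t).add_const δ).sqrt h0 using 1
  rw [sgnApprox]
  field_simp
  ring

theorem continuous_sgnApprox {δ : ℝ} (hδ : 0 < δ) : Continuous (sgnApprox δ) := by
  unfold sgnApprox
  exact continuous_id.div (by fun_prop) fun t => (Real.sqrt_pos.2 (by positivity)).ne'

theorem hasDerivAt_sgnApprox {δ : ℝ} (hδ : 0 < δ) (t : ℝ) :
    HasDerivAt (sgnApprox δ) (δ / (√(t ^ 2 + δ)) ^ 3) t := by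
  have h : 0 < √(t ^ 2 + δ) := Real.sqrt_pos.2 (by positivity)
  refine HasDerivAt.congr_deriv (f := sgnApprox δ)
    ((hasDerivAt_id t).div (hasDerivAt_sqrt_sq_add hδ t) h.ne') ?_
  have h2 : (√(t ^ 2 + δ)) ^ 2 = t ^ 2 + δ := Real.sq_sqrt (by positivity)
  rw [sgnApprox]
  have h3 : δ = (√(t ^ 2 + δ)) ^ 2 - t ^ 2 := by linarith
  simp only [id]
  field_simp
  linarith

theorem sgnApprox_tendsto {δ : ℕ → ℝ} (h : Tendsto δ atTop (𝓝 0)) (t : ℝ) :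
    Tendsto (fun k => sgnApprox (δ k) t) atTop (𝓝 (Real.sign t)) := by
  rcases eq_or_ne t 0 with rfl | ht
  · simp [sgnApprox]
  · have h1 : Tendsto (fun k => √(t ^ 2 + δ k)) atTop (𝓝 √(t ^ 2 + 0)) :=
      ((h.const_add (t ^ 2))).sqrt
    rw [add_zero, Real.sqrt_sq_eq_abs] at h1
    have h2 := (tendsto_const_nhds (x := t)).div h1 (abs_ne_zero.2 ht)
    have e : t / |t| = Real.sign t := by
      rcases lt_or_gt_of_ne ht with h | h
      · rw [abs_of_neg h, Real.sign_of_neg h, div_neg, div_self ht]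
      · rw [abs_of_pos h, Real.sign_of_pos h, div_self ht]
    rwa [e] at h2

theorem sqrt_sq_add_eq {δ : ℝ} (hδ : 0 < δ) (t : ℝ) :
    √(t ^ 2 + δ) = t * sgnApprox δ t + δ / √(t ^ 2 + δ) := by
  have h : 0 < √(t ^ 2 + δ) := Real.sqrt_pos.2 (by positivity)
  have h2 : (√(t ^ 2 + δ)) ^ 2 = t ^ 2 + δ := Real.sq_sqrt (by positivity)
  rw [sgnApprox]
  field_simp
  exact h2

theorem div_sqrt_sq_add_le {δ : ℝ} (hδ : 0 < δ) (t : ℝ) : |δ / √(t ^ 2 + δ)| ≤ √δ := by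
  have h : 0 < √δ := Real.sqrt_pos.2 hδ
  rw [abs_of_nonneg (by positivity)]
  calc δ / √(t ^ 2 + δ) ≤ δ / √δ := by
        gcongr
        nlinarith [sq_nonneg t]
    _ = √δ := Real.div_sqrt

theorem kato_regularized {N : ℕ} {Ω : Set (Eu N)} {V₁ V₂ F₁ F₂ φ : Eu N → ℝ} (hV₁ : Integrable V₁)
    (hV₂ : Integrable V₂) (hF₁ : Integrable F₁) (hF₂ : Integrable F₂) (hφ : IsTestFun Ω φ)
    (h0 : ∀ x, 0 ≤ φ x) {n : ℕ}
    (h₁ : ∀ x ∈ tsupport φ, moll n F₁ x ≤ laplacian (moll n V₁) x)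
    (h₂ : ∀ x ∈ tsupport φ, moll n F₂ x ≤ laplacian (moll n V₂) x) {δ : ℝ} (hδ : 0 < δ) :
    (∫ x, moll n F₁ x * ((1 + sgnApprox δ (moll n V₁ x - moll n V₂ x)) * φ x)) +
      (∫ x, moll n F₂ x * ((1 - sgnApprox δ (moll n V₁ x - moll n V₂ x)) * φ x)) ≤
    ((∫ x, moll n V₁ x * ((1 + sgnApprox δ (moll n V₁ x - moll n V₂ x)) * laplacian φ x)) +
      (∫ x, moll n V₂ x * ((1 - sgnApprox δ (moll n V₁ x - moll n V₂ x)) * laplacian φ x))) +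
      √δ * ∫ x, |laplacian φ x| := by
  set a := moll n V₁ with ha
  set b := moll n V₂ with hb
  have ca : ContDiff ℝ ∞ a := contDiff_moll n hV₁
  have cb : ContDiff ℝ ∞ b := contDiff_moll n hV₂
  have cf₁ : Continuous (moll n F₁) := (contDiff_moll n hF₁).continuous
  have cf₂ : Continuous (moll n F₂) := (contDiff_moll n hF₂).continuous
  have cs : ContDiff ℝ ∞ (fun x => a x - b x) := ca.sub cb
  have cσ : Continuous (fun x => sgnApprox δ (a x - b x)) :=
    (continuous_sgnApprox hδ).comp cs.continuous
  have cΦ : ContDiff ℝ ∞ (fun t : ℝ => √(t ^ 2 + δ)) :=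
    ContDiff.sqrt (by fun_prop) fun t => by positivity
  have cr : ContDiff ℝ ∞ (fun x => √((a x - b x) ^ 2 + δ)) := cΦ.comp cs
  have cφ := hφ.1.continuous
  have cL := hφ.1.laplacian.continuous
  have iφ : ∀ {f : Eu N → ℝ}, Continuous f → Integrable (fun x => f x * φ x) := fun hf =>
    (hf.mul cφ).integrable_of_hasCompactSupport hφ.2.1.mul_left
  have iL : ∀ {f : Eu N → ℝ}, Continuous f → Integrable (fun x => f x * laplacian φ x) := fun hf =>
    (hf.mul cL).integrable_of_hasCompactSupport (hφ.2.1.laplacian hφ.1).mul_left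
  have i1 := iφ (cf₁.mul (continuous_const.add cσ) : Continuous
    (fun x => moll n F₁ x * (1 + sgnApprox δ (a x - b x))))
  have i2 := iφ (cf₂.mul (continuous_const.sub cσ) : Continuous
    (fun x => moll n F₂ x * (1 - sgnApprox δ (a x - b x))))
  have i3 := iL (ca.continuous.mul (continuous_const.add cσ) : Continuous
    (fun x => a x * (1 + sgnApprox δ (a x - b x))))
  have i4 := iL (cb.continuous.mul (continuous_const.sub cσ) : Continuous
    (fun x => b x * (1 - sgnApprox δ (a x - b x))))
  have iabs : Integrable (fun x => |laplacian φ x|) :=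
    (cL.integrable_of_hasCompactSupport (hφ.2.1.laplacian hφ.1)).abs
  replace i1 := i1.congr (ae_of_all _ fun x => mul_assoc _ _ _)
  replace i2 := i2.congr (ae_of_all _ fun x => mul_assoc _ _ _)
  replace i3 := i3.congr (ae_of_all _ fun x => mul_assoc _ _ _)
  replace i4 := i4.congr (ae_of_all _ fun x => mul_assoc _ _ _)
  dsimp only at i1 i2 i3 i4
  have i34 : Integrable (fun x => a x * ((1 + sgnApprox δ (a x - b x)) * laplacian φ x) +
    b x * ((1 - sgnApprox δ (a x - b x)) * laplacian φ x)) := i3.add i4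
  rw [← integral_add i1 i2, ← integral_add i3 i4, ← integral_const_mul,
    ← integral_add i34 (iabs.const_mul _)]
  have cG : ContDiff ℝ ∞ (fun x => (a x + b x) + √((a x - b x) ^ 2 + δ)) := (ca.add cb).add cr
  have step1 : ∫ x, (moll n F₁ x * ((1 + sgnApprox δ (a x - b x)) * φ x) +
      moll n F₂ x * ((1 - sgnApprox δ (a x - b x)) * φ x)) ≤
      ∫ x, laplacian (fun x => (a x + b x) + √((a x - b x) ^ 2 + δ)) x * φ x := by
    refine integral_mono (i1.add i2) (iφ cG.laplacian.continuous) fun x => ?_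
    dsimp only [Pi.add_apply]
    by_cases hx : x ∈ tsupport φ
    · rw [laplacian_add (ca.add cb) cr, laplacian_add ca cb]
      have k := laplacian_comp_ge cs cΦ (hasDerivAt_sqrt_sq_add hδ) (hasDerivAt_sgnApprox hδ)
        (fun t => by positivity) x
      rw [laplacian_sub ca cb] at k
      have k1 := h₁ x hx
      have k2 := h₂ x hx
      have k3 := abs_le.1 (abs_sgnApprox_le hδ (a x - b x))
      have k4 := h0 x
      have e1 := mul_le_mul_of_nonneg_left k1
        (by linarith : 0 ≤ 1 + sgnApprox δ (a x - b x))
      have e2 := mul_le_mul_of_nonneg_left k2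
        (by linarith : 0 ≤ 1 - sgnApprox δ (a x - b x))
      have e3 : moll n F₁ x * (1 + sgnApprox δ (a x - b x)) +
        moll n F₂ x * (1 - sgnApprox δ (a x - b x)) ≤
        laplacian a x + laplacian b x + laplacian (fun x => √((a x - b x) ^ 2 + δ)) x := by
        linarith
      linarith [mul_le_mul_of_nonneg_right e3 k4]
    · simp [image_eq_zero_of_notMem_tsupport hx]
  refine step1.trans ?_
  rw [← integral_mul_laplacian cG hφ.1 hφ.2.1]
  refine integral_mono (iL cG.continuous) ((i3.add i4).add (iabs.const_mul _)) fun x => ?_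
  have k1 := sqrt_sq_add_eq hδ (a x - b x)
  have k2 := div_sqrt_sq_add_le hδ (a x - b x)
  have k3 : δ / √((a x - b x) ^ 2 + δ) * laplacian φ x ≤ √δ * |laplacian φ x| := by
    refine (le_abs_self _).trans ?_
    rw [abs_mul]
    exact mul_le_mul_of_nonneg_right k2 (abs_nonneg _)
  have k4 := congrArg (· * laplacian φ x) k1
  linarith

theorem exists_abs_le_of_hasCompactSupport {N : ℕ} {f : Eu N → ℝ} (h : Continuous f)
    (hc : HasCompactSupport f) : ∃ C, ∀ x, |f x| ≤ C :=
  hc.exists_bound_of_continuous h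

theorem integral_sgnApprox_tendsto {N : ℕ} {A : ℕ → Eu N → ℝ} {a φ : Eu N → ℝ}
    {S : ℕ → Eu N → ℝ} {τ : Eu N → ℝ} {e : ℝ} (he : |e| ≤ 1) (hA : ∀ n, Integrable (A n))
    (ha : Integrable a) (hL : Tendsto (fun n => ∫ x, |A n x - a x|) atTop (𝓝 0))
    (hS : ∀ n, AEStronglyMeasurable (S n)) (hb : ∀ n x, |S n x| ≤ 1)
    (hφ : Continuous φ) (hc : HasCompactSupport φ)
    (ht : ∀ᵐ x, Tendsto (fun n => S n x) atTop (𝓝 (τ x))) :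
    Tendsto (fun n => ∫ x, A n x * ((1 + e * S n x) * φ x)) atTop
      (𝓝 (∫ x, a x * ((1 + e * τ x) * φ x))) := by
  obtain ⟨C, hC⟩ := exists_abs_le_of_hasCompactSupport hφ hc
  refine tendsto_integral_mul_of_L1 (C := 2 * C) hA ha hL (fun n => ?_) (fun n x => ?_) ?_
  · exact (((hS n).const_mul e).const_add 1).mul hφ.aestronglyMeasurable
  · rw [abs_mul]
    refine mul_le_mul ?_ (hC x) (abs_nonneg _) (by norm_num)
    refine (abs_add_le _ _).trans ?_
    rw [abs_one, abs_mul]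
    have := mul_le_mul he (hb n x) (abs_nonneg _) zero_le_one
    linarith
  · filter_upwards [ht] with x hx
    exact ((hx.const_mul e).const_add 1).mul_const _

theorem kato_integrable {N : ℕ} {Ω : Set (Eu N)} {V₁ V₂ F₁ F₂ φ : Eu N → ℝ} (hV₁ : Integrable V₁)
    (hV₂ : Integrable V₂) (hF₁ : Integrable F₁) (hF₂ : Integrable F₂) (hφ : IsTestFun Ω φ)
    (h0 : ∀ x, 0 ≤ φ x)
    (h₁ : ∀ᶠ n in atTop, ∀ x ∈ tsupport φ, moll n F₁ x ≤ laplacian (moll n V₁) x)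
    (h₂ : ∀ᶠ n in atTop, ∀ x ∈ tsupport φ, moll n F₂ x ≤ laplacian (moll n V₂) x) :
    (∫ x, F₁ x * ((1 + 1 * Real.sign (V₁ x - V₂ x)) * φ x)) +
      (∫ x, F₂ x * ((1 + (-1) * Real.sign (V₁ x - V₂ x)) * φ x)) ≤
    (∫ x, V₁ x * ((1 + 1 * Real.sign (V₁ x - V₂ x)) * laplacian φ x)) +
      (∫ x, V₂ x * ((1 + (-1) * Real.sign (V₁ x - V₂ x)) * laplacian φ x)) := by
  have cφ := hφ.1.continuous
  have cL := hφ.1.laplacian.continuous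
  have kL := hφ.2.1.laplacian hφ.1
  have p1 : |(1 : ℝ)| ≤ 1 := by simp
  have p2 : |(-1 : ℝ)| ≤ 1 := by simp
  have main : ∀ δ : ℝ, 0 < δ →
      (∫ x, F₁ x * ((1 + 1 * sgnApprox δ (V₁ x - V₂ x)) * φ x)) +
      (∫ x, F₂ x * ((1 + (-1) * sgnApprox δ (V₁ x - V₂ x)) * φ x)) ≤
      ((∫ x, V₁ x * ((1 + 1 * sgnApprox δ (V₁ x - V₂ x)) * laplacian φ x)) +
      (∫ x, V₂ x * ((1 + (-1) * sgnApprox δ (V₁ x - V₂ x)) * laplacian φ x))) +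
      √δ * ∫ x, |laplacian φ x| := by
    intro δ hδ
    have hS : ∀ n, AEStronglyMeasurable (fun x => sgnApprox δ (moll n V₁ x - moll n V₂ x)) := fun n =>
      ((continuous_sgnApprox hδ).comp
        ((contDiff_moll n hV₁).sub (contDiff_moll n hV₂)).continuous).aestronglyMeasurable
    have hb : ∀ n x, |sgnApprox δ (moll n V₁ x - moll n V₂ x)| ≤ 1 := fun n x =>
      abs_sgnApprox_le hδ _
    have ht : ∀ᵐ x, Tendsto (fun n => sgnApprox δ (moll n V₁ x - moll n V₂ x)) atTop
        (𝓝 (sgnApprox δ (V₁ x - V₂ x))) := by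
      filter_upwards [moll_ae_tendsto hV₁, moll_ae_tendsto hV₂] with x hx hx'
      exact ((continuous_sgnApprox hδ).tendsto _).comp (hx.sub hx')
    refine le_of_tendsto_of_tendsto (b := atTop (α := ℕ))
      ((integral_sgnApprox_tendsto p1 (fun n => integrable_moll n hF₁) hF₁
        (moll_L1_tendsto hF₁) hS hb cφ hφ.2.1 ht).add
       (integral_sgnApprox_tendsto p2 (fun n => integrable_moll n hF₂) hF₂
        (moll_L1_tendsto hF₂) hS hb cφ hφ.2.1 ht))
      (((integral_sgnApprox_tendsto p1 (fun n => integrable_moll n hV₁) hV₁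
        (moll_L1_tendsto hV₁) hS hb cL kL ht).add
       (integral_sgnApprox_tendsto p2 (fun n => integrable_moll n hV₂) hV₂
        (moll_L1_tendsto hV₂) hS hb cL kL ht)).add_const _) ?_
    filter_upwards [h₁, h₂] with n k₁ k₂
    have := kato_regularized hV₁ hV₂ hF₁ hF₂ hφ h0 k₁ k₂ hδ
    simpa only [one_mul, neg_mul, ← sub_eq_add_neg] using this
  have hδ : ∀ k : ℕ, (0 : ℝ) < 1 / ((k : ℝ) + 1) := fun k => by positivity
  have hδt : Tendsto (fun k : ℕ => 1 / ((k : ℝ) + 1)) atTop (𝓝 0) :=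
    tendsto_one_div_add_atTop_nhds_zero_nat
  have hS : ∀ k : ℕ, AEStronglyMeasurable (fun x => sgnApprox (1 / ((k : ℝ) + 1)) (V₁ x - V₂ x)) :=
    fun k => (continuous_sgnApprox (hδ k)).comp_aestronglyMeasurable
      (hV₁.sub hV₂).aestronglyMeasurable
  have hb : ∀ (k : ℕ) x, |sgnApprox (1 / ((k : ℝ) + 1)) (V₁ x - V₂ x)| ≤ 1 := fun k x =>
    abs_sgnApprox_le (hδ k) _
  have ht : ∀ᵐ x, Tendsto (fun k : ℕ => sgnApprox (1 / ((k : ℝ) + 1)) (V₁ x - V₂ x)) atTop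
      (𝓝 (Real.sign (V₁ x - V₂ x))) := ae_of_all _ fun x => sgnApprox_tendsto hδt _
  have z : ∀ f : Eu N → ℝ, Tendsto (fun _ : ℕ => ∫ x, |f x - f x|) atTop (𝓝 0) := fun f => by simp
  have sq0 : Tendsto (fun k : ℕ => √(1 / ((k : ℝ) + 1)) * ∫ x, |laplacian φ x|) atTop (𝓝 0) := by
    have := hδt.sqrt.mul_const (∫ x, |laplacian φ x|)
    simpa using this
  have := le_of_tendsto_of_tendsto'
      ((integral_sgnApprox_tendsto p1 (fun _ => hF₁) hF₁ (z _) hS hb cφ hφ.2.1 ht).add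
       (integral_sgnApprox_tendsto p2 (fun _ => hF₂) hF₂ (z _) hS hb cφ hφ.2.1 ht))
      (((integral_sgnApprox_tendsto p1 (fun _ => hV₁) hV₁ (z _) hS hb cL kL ht).add
       (integral_sgnApprox_tendsto p2 (fun _ => hV₂) hV₂ (z _) hS hb cL kL ht)).add sq0)
      (fun k => main _ (hδ k))
  simpa only [add_zero] using this

/-- The coefficient of the first function in the distributional Laplacian of a maximum. -/
def maxWt (t : ℝ) : ℝ := (1 + Real.sign t) / 2

theorem maxWt_of_pos {t : ℝ} (h : 0 < t) : maxWt t = 1 := by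
  rw [maxWt, Real.sign_of_pos h]; norm_num

theorem maxWt_of_neg {t : ℝ} (h : t < 0) : maxWt t = 0 := by
  rw [maxWt, Real.sign_of_neg h]; norm_num

theorem maxWt_zero : maxWt 0 = 1 / 2 := by
  rw [maxWt, Real.sign_zero, add_zero]

theorem abs_maxWt_le (t : ℝ) : |maxWt t| ≤ 1 := by
  rcases lt_trichotomy t 0 with h | rfl | h
  · rw [maxWt_of_neg h]; norm_num
  · rw [maxWt_zero, abs_of_pos] <;> norm_num
  · rw [maxWt_of_pos h]; norm_num

theorem maxWt_max (a b : ℝ) : a * maxWt (a - b) + b * (1 - maxWt (a - b)) = max a b := by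
  rcases lt_trichotomy a b with h | rfl | h
  · rw [maxWt_of_neg (by linarith), max_eq_right h.le]; ring
  · rw [sub_self, max_self]; ring
  · rw [maxWt_of_pos (by linarith), max_eq_left h.le]; ring

theorem measurable_maxWt : Measurable maxWt := by
  have : maxWt = fun t => if t < 0 then 0 else if t = 0 then 1 / 2 else 1 := by
    funext t
    rcases lt_trichotomy t 0 with h | rfl | h
    · simp [maxWt_of_neg h, h]
    · simp [maxWt_zero]
    · simp [maxWt_of_pos h, h.not_gt, h.ne']
  rw [this]
  exact Measurable.ite measurableSet_Iio measurable_const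
    (Measurable.ite (measurableSet_singleton _) measurable_const measurable_const)

theorem LocallyIntegrableOn.mul_bdd' {N : ℕ} {Ω : Set (Eu N)} {f ψ : Eu N → ℝ}
    (hΩ : IsOpen Ω) (hf : LocallyIntegrableOn f Ω) (hm : AEStronglyMeasurable ψ (volume.restrict Ω))
    (hb : ∀ x, |ψ x| ≤ 1) : LocallyIntegrableOn (fun x => f x * ψ x) Ω := by
  rw [locallyIntegrableOn_iff hΩ.isLocallyClosed] at hf ⊢
  intro K hK hKc
  exact (hf K hK hKc).mul_bdd (c := 1) (hm.mono_measure (Measure.restrict_mono hK le_rfl))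
    (ae_of_all _ hb)

theorem eventually_moll_le {N : ℕ} {Ω : Set (Eu N)} {v f : Eu N → ℝ} (h : LapGE Ω v f)
    {ε : ℝ} (hε : 0 < ε) {T : Set (Eu N)} (hT : IsCompact T) (hs : Metric.cthickening ε T ⊆ Ω) :
    ∀ᶠ n : ℕ in atTop, ∀ x ∈ T,
      moll n ((Metric.cthickening ε T).indicator f) x ≤
        laplacian (moll n ((Metric.cthickening ε T).indicator v)) x := by
  have := (tendsto_one_div_add_atTop_nhds_zero_nat (𝕜 := ℝ)).eventually (eventually_le_nhds hε)
  filter_upwards [this] with n hn x hx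
  refine h.le_laplacian_moll hT.cthickening hs ?_
  exact (Metric.closedBall_subset_closedBall hn).trans (Metric.closedBall_subset_cthickening hx ε)

theorem kato_max_integrable {N : ℕ} {Ω : Set (Eu N)} {V₁ V₂ F₁ F₂ φ : Eu N → ℝ}
    (hV₁ : Integrable V₁) (hV₂ : Integrable V₂) (hF₁ : Integrable F₁) (hF₂ : Integrable F₂)
    (hφ : IsTestFun Ω φ) (h0 : ∀ x, 0 ≤ φ x)
    (h₁ : ∀ᶠ n in atTop, ∀ x ∈ tsupport φ, moll n F₁ x ≤ laplacian (moll n V₁) x)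
    (h₂ : ∀ᶠ n in atTop, ∀ x ∈ tsupport φ, moll n F₂ x ≤ laplacian (moll n V₂) x) :
    ∫ x, (F₁ x * maxWt (V₁ x - V₂ x) + F₂ x * (1 - maxWt (V₁ x - V₂ x))) * φ x ≤
      ∫ x, max (V₁ x) (V₂ x) * laplacian φ x := by
  have key := kato_integrable hV₁ hV₂ hF₁ hF₂ hφ h0 h₁ h₂
  have ms : AEStronglyMeasurable (fun x => maxWt (V₁ x - V₂ x)) :=
    (measurable_maxWt.comp_aemeasurable (hV₁.sub hV₂).aestronglyMeasurable.aemeasurable).aestronglyMeasurable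
  have hi : ∀ (e : ℝ) (A ψ : Eu N → ℝ), |e| ≤ 1 → Integrable A → Continuous ψ →
      HasCompactSupport ψ → Integrable fun x => A x * ((1 + e * Real.sign (V₁ x - V₂ x)) * ψ x) := by
    intro e A ψ he hA hψ hc
    obtain ⟨C, hC⟩ := exists_abs_le_of_hasCompactSupport hψ hc
    have e1 : ∀ t, Real.sign t = 2 * maxWt t - 1 := fun t => by rw [maxWt]; ring
    have e2 : ∀ t, |Real.sign t| ≤ 1 := fun t => by
      rcases Real.sign_apply_eq t with h | h | h <;> rw [h] <;> norm_num
    refine hA.mul_bdd (c := 2 * C) ?_ (ae_of_all _ fun x => ?_)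
    · simp_rw [e1]
      exact (aestronglyMeasurable_const.add (((ms.const_mul 2).sub
        aestronglyMeasurable_const).const_mul e)).mul hψ.aestronglyMeasurable
    · rw [norm_mul]
      refine mul_le_mul ?_ (hC x) (abs_nonneg _) (by norm_num)
      refine (abs_add_le _ _).trans ?_
      rw [abs_one, abs_mul]
      have := mul_le_mul he (e2 (V₁ x - V₂ x)) (abs_nonneg _) zero_le_one
      linarith
  have cφ := hφ.1.continuous
  have cL := hφ.1.laplacian.continuous
  have kL := hφ.2.1.laplacian hφ.1
  have p1 : |(1 : ℝ)| ≤ 1 := by simp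
  have p2 : |(-1 : ℝ)| ≤ 1 := by simp
  rw [← integral_add (hi _ _ _ p1 hF₁ cφ hφ.2.1) (hi _ _ _ p2 hF₂ cφ hφ.2.1),
    ← integral_add (hi _ _ _ p1 hV₁ cL kL) (hi _ _ _ p2 hV₂ cL kL)] at key
  have key2 := mul_le_mul_of_nonneg_left key (by norm_num : (0 : ℝ) ≤ 1 / 2)
  rw [← integral_const_mul, ← integral_const_mul] at key2
  refine (integral_congr_ae (ae_of_all _ fun x => ?_)).trans_le
    (key2.trans_eq (integral_congr_ae (ae_of_all _ fun x => ?_)))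
  · rw [maxWt]; ring
  · dsimp only; rw [← maxWt_max, maxWt]; ring

/-- Kato's inequality for the maximum of two functions. -/
theorem LapGE.max {N : ℕ} {Ω : Set (Eu N)} (hΩ : IsOpen Ω) {v₁ v₂ f₁ f₂ : Eu N → ℝ}
    (h₁ : LapGE Ω v₁ f₁) (h₂ : LapGE Ω v₂ f₂) :
    LapGE Ω (fun x => max (v₁ x) (v₂ x))
      (fun x => f₁ x * maxWt (v₁ x - v₂ x) + f₂ x * (1 - maxWt (v₁ x - v₂ x))) := by
  have mw : AEStronglyMeasurable (fun x => maxWt (v₁ x - v₂ x)) (volume.restrict Ω) :=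
    (measurable_maxWt.comp_aemeasurable ((h₁.1.sub h₂.1).aestronglyMeasurable).aemeasurable).aestronglyMeasurable
  have mw' : AEStronglyMeasurable (fun x => 1 - maxWt (v₁ x - v₂ x)) (volume.restrict Ω) :=
    aestronglyMeasurable_const.sub mw
  have hb' : ∀ t, |1 - maxWt t| ≤ 1 := fun t => by
    rcases lt_trichotomy t 0 with h | rfl | h
    · rw [maxWt_of_neg h]; norm_num
    · rw [maxWt_zero, abs_of_pos] <;> norm_num
    · rw [maxWt_of_pos h]; norm_num
  refine ⟨?_, ?_, fun φ hφ h0 => ?_⟩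
  · simp_rw [← maxWt_max]
    exact (LocallyIntegrableOn.mul_bdd' hΩ h₁.1 mw fun x => abs_maxWt_le _).add
      (LocallyIntegrableOn.mul_bdd' hΩ h₂.1 mw' fun x => hb' _)
  · exact (LocallyIntegrableOn.mul_bdd' hΩ h₁.2.1 mw fun x => abs_maxWt_le _).add
      (LocallyIntegrableOn.mul_bdd' hΩ h₂.2.1 mw' fun x => hb' _)
  obtain ⟨ε, hε, hs⟩ := hφ.2.1.isCompact.exists_cthickening_subset_open hΩ hφ.2.2
  have hK : IsCompact (Metric.cthickening ε (tsupport φ)) := hφ.2.1.isCompact.cthickening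
  set K := Metric.cthickening ε (tsupport φ) with hKdef
  have hi : ∀ {f : Eu N → ℝ}, LocallyIntegrableOn f Ω → Integrable (K.indicator f) := fun hf =>
    (integrable_indicator_iff hK.measurableSet).2 (hf.integrableOn_compact_subset hs hK)
  have key := kato_max_integrable (hi h₁.1) (hi h₂.1) (hi h₁.2.1) (hi h₂.2.1) hφ h0
    (eventually_moll_le h₁ hε hφ.2.1 hs) (eventually_moll_le h₂ hε hφ.2.1 hs)
  have hsub : tsupport φ ⊆ K := Metric.self_subset_cthickening _
  convert key using 2
  · funext x
    by_cases hx : x ∈ K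
    · simp [hx]
    · simp [image_eq_zero_of_notMem_tsupport fun h => hx (hsub h)]
  · funext x
    by_cases hx : x ∈ K
    · simp [hx]
    · have : laplacian φ x = 0 := image_eq_zero_of_notMem_tsupport fun h =>
        hx (hsub (tsupport_laplacian_subset hφ.1 h))
      simp [this]

open scoped Manifold in
theorem exists_cutoff {N : ℕ} {Ω K : Set (Eu N)} (hΩ : IsOpen Ω) (hK : IsCompact K) (h : K ⊆ Ω) :
    ∃ η : Eu N → ℝ, IsTestFun Ω η ∧ (∀ x, 0 ≤ η x) ∧ (∀ x ∈ K, η =ᶠ[𝓝 x] fun _ => 1) := by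
  obtain ⟨ε, hε, hs⟩ := hK.exists_cthickening_subset_open hΩ h
  have hd : K ⊆ interior (Metric.cthickening ε K) :=
    (Metric.self_subset_thickening hε K).trans
      (interior_maximal (Metric.thickening_subset_cthickening _ _) Metric.isOpen_thickening)
  obtain ⟨f, h1, h2, h3⟩ := exists_contMDiffMap_one_nhds_of_subset_interior 𝓘(ℝ, Eu N) (n := ⊤)
    hK.isClosed hd
  have ht : tsupport f ⊆ Metric.cthickening ε K := by
    refine closure_minimal (fun x hx => ?_) Metric.isClosed_cthickening
    by_contra h
    exact hx (h2 x h)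
  refine ⟨f, ⟨f.contMDiff.contDiff, hK.cthickening.of_isClosed_subset (isClosed_tsupport _) ht,
    ht.trans hs⟩, fun x => (h3 x).1, fun x hx => ?_⟩
  exact h1.filter_mono (nhds_le_nhdsSet hx)

theorem laplacian_congr {N : ℕ} {φ ψ : Eu N → ℝ} {x : Eu N} (h : φ =ᶠ[𝓝 x] ψ) :
    laplacian φ x = laplacian ψ x := by
  simp only [laplacian, (h.iteratedFDeriv ℝ 2).eq_of_nhds]

theorem laplacian_const_sub_norm_sq {N : ℕ} (c : ℝ) (x : Eu N) :
    laplacian (fun x : Eu N => c - ‖x‖ ^ 2) x = -(2 * N) := by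
  have hc : ContDiff ℝ ∞ (fun x : Eu N => c - ‖x‖ ^ 2) :=
    contDiff_const.sub (contDiff_norm_sq ℝ)
  have h1 : ∀ i : Fin N, pd i (fun x : Eu N => c - ‖x‖ ^ 2) = fun x => (-2) * x i := by
    intro i
    funext y
    have := ((hasStrictFDerivAt_norm_sq (F := Eu N) y).hasFDerivAt.const_sub c).fderiv
    rw [pd, this]
    simp [EuclideanSpace.inner_single_right]
  rw [laplacian_eq_sum_pd hc]
  have h2 : ∀ i : Fin N, pd i (pd i (fun x : Eu N => c - ‖x‖ ^ 2)) x = -2 := by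
    intro i
    rw [h1, pd]
    have : HasFDerivAt (fun x : Eu N => (-2) * x i)
        ((-2 : ℝ) • (EuclideanSpace.proj i : Eu N →L[ℝ] ℝ)) x :=
      ((EuclideanSpace.proj i : Eu N →L[ℝ] ℝ).hasFDerivAt).const_mul (-2)
    rw [this.fderiv]
    simp
  simp only [h2, Finset.sum_const, Finset.card_univ, Fintype.card_fin, nsmul_eq_mul]
  ring

/-- A nonnegative subharmonic function vanishing off a compact subset is zero. -/
theorem LapGE.ae_eq_zero {N : ℕ} (hN : 0 < N) {Ω K : Set (Eu N)} (hΩ : IsOpen Ω) (hK : IsCompact K)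
    (hKΩ : K ⊆ Ω) {z f : Eu N → ℝ} (h : LapGE Ω z f) (hf : ∀ᵐ x, x ∈ Ω → 0 ≤ f x)
    (hz : ∀ᵐ x, x ∈ Ω → 0 ≤ z x) (hzK : ∀ᵐ x, x ∈ Ω → x ∉ K → z x = 0) :
    ∀ᵐ x, x ∈ Ω → z x = 0 := by
  obtain ⟨η, hη, η0, η1⟩ := exists_cutoff hΩ hK hKΩ
  obtain ⟨R, hR⟩ := hη.2.1.isCompact.isBounded.subset_closedBall 0
  set φ : Eu N → ℝ := fun x => (R ^ 2 - ‖x‖ ^ 2) * η x with hφdef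
  have hφ : IsTestFun Ω φ :=
    ⟨(contDiff_const.sub (contDiff_norm_sq ℝ)).mul hη.1, hη.2.1.mul_left,
      (closure_mono (Function.support_mul_subset_right _ _)).trans hη.2.2⟩
  have φ0 : ∀ x, 0 ≤ φ x := by
    intro x
    by_cases hx : x ∈ tsupport η
    · have : ‖x‖ ≤ R := by simpa using hR hx
      have : ‖x‖ ^ 2 ≤ R ^ 2 := pow_le_pow_left₀ (norm_nonneg _) this 2
      exact mul_nonneg (by linarith) (η0 x)
    · simp [hφdef, image_eq_zero_of_notMem_tsupport hx]
  have hL : ∀ x ∈ K, laplacian φ x = -(2 * N) := by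
    intro x hx
    rw [← laplacian_const_sub_norm_sq (R ^ 2) x]
    refine laplacian_congr ?_
    filter_upwards [η1 x hx] with y hy
    simp [hφdef, hy]
  have key := h.2.2 φ hφ φ0
  have hle : 0 ≤ ∫ x, f x * φ x := by
    refine integral_nonneg_of_ae ?_
    filter_upwards [hf] with x hx
    by_cases hxΩ : x ∈ Ω
    · exact mul_nonneg (hx hxΩ) (φ0 x)
    · have : φ x = 0 := image_eq_zero_of_notMem_tsupport fun h' => hxΩ (hφ.2.2 h')
      simp [this]
  have e : ∫ x, z x * laplacian φ x = -(2 * N) * ∫ x in K, z x := by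
    rw [← integral_indicator hK.measurableSet, ← integral_const_mul]
    refine integral_congr_ae ?_
    filter_upwards [hzK] with x hx
    by_cases hxK : x ∈ K
    · simp [hxK, hL x hxK, mul_comm]
    · by_cases hxΩ : x ∈ Ω
      · simp [hxK, hx hxΩ hxK]
      · have : laplacian φ x = 0 :=
          image_eq_zero_of_notMem_tsupport fun h' => hxΩ (hφ.tsupport_laplacian h')
        simp [hxK, this]
  have hN' : (0 : ℝ) < N := by exact_mod_cast hN
  have hzK0 : 0 ≤ᵐ[volume.restrict K] z := by
    refine (ae_restrict_iff' hK.measurableSet).2 ?_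
    filter_upwards [hz] with x hx hxK using hx (hKΩ hxK)
  have h0 : ∫ x in K, z x = 0 := by
    refine le_antisymm ?_ (integral_nonneg_of_ae hzK0)
    rw [e] at key
    nlinarith
  have h2 := (setIntegral_eq_zero_iff_of_nonneg_ae hzK0
    (h.1.integrableOn_compact_subset hKΩ hK)).1 h0
  have h3 := (ae_restrict_iff' hK.measurableSet).1 h2
  filter_upwards [h3, hzK] with x hx hx' hxΩ
  by_cases hxK : x ∈ K
  · exact hx hxK
  · exact hx' hxΩ hxK

/-- The absorption nonlinearity. -/
def nl (q t : ℝ) : ℝ := |t| ^ (q - 1) * t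

theorem continuous_nl {q : ℝ} (hq : 1 < q) : Continuous (nl q) :=
  (continuous_abs.rpow_const fun _ => Or.inr (by linarith)).mul continuous_id

theorem nl_zero (q : ℝ) : nl q 0 = 0 := mul_zero _

theorem nl_of_nonneg {q t : ℝ} (hq : 1 < q) (ht : 0 ≤ t) : nl q t = t ^ q := by
  rcases ht.eq_or_lt with rfl | h
  · rw [nl_zero, Real.zero_rpow (by linarith)]
  · rw [nl, abs_of_pos h, Real.rpow_sub_one h.ne', div_mul_cancel₀ _ h.ne']

theorem abs_nl {q : ℝ} (hq : 1 < q) (t : ℝ) : |nl q t| = |t| ^ q := by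
  rw [← nl_of_nonneg hq (abs_nonneg t), nl, nl, abs_mul, abs_abs,
    abs_of_nonneg (Real.rpow_nonneg (abs_nonneg t) _)]

theorem nl_le_nl {q s t : ℝ} (hq : 1 < q) (hs : 0 ≤ s) (h : s ≤ t) : nl q s ≤ nl q t := by
  rw [nl_of_nonneg hq hs, nl_of_nonneg hq (hs.trans h)]
  exact Real.rpow_le_rpow hs h (by linarith)

theorem nl_nonneg {q t : ℝ} (hq : 1 < q) (ht : 0 ≤ t) : 0 ≤ nl q t := by
  rw [nl_of_nonneg hq ht]; exact Real.rpow_nonneg ht _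

theorem ae_restrict_iff_of_isOpen {N : ℕ} {Ω : Set (Eu N)} (hΩ : IsOpen Ω) {p : Eu N → Prop} :
    (∀ᵐ x ∂(volume.restrict Ω), p x) ↔ ∀ᵐ x, x ∈ Ω → p x :=
  ae_restrict_iff' hΩ.measurableSet

theorem locallyIntegrableOn_of_abs_le {N : ℕ} {Ω : Set (Eu N)} (hΩ : IsOpen Ω) {f g : Eu N → ℝ}
    (hf : AEStronglyMeasurable f (volume.restrict Ω)) (hg : LocallyIntegrableOn g Ω)
    (h : ∀ᵐ x, x ∈ Ω → |f x| ≤ g x) : LocallyIntegrableOn f Ω := by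
  rw [locallyIntegrableOn_iff hΩ.isLocallyClosed] at hg ⊢
  intro K hK hKc
  refine (hg K hK hKc).mono' (hf.mono_measure (Measure.restrict_mono hK le_rfl)) ?_
  refine (ae_restrict_iff' hKc.measurableSet).2 ?_
  filter_upwards [h] with x hx hxK using hx (hK hxK)

theorem MemLqLoc.locallyIntegrableOn {N : ℕ} {q : ℝ} (hq : 1 < q) {Ω : Set (Eu N)} (hΩ : IsOpen Ω)
    {u : Eu N → ℝ} (h : MemLqLoc q Ω u) :
    LocallyIntegrableOn u Ω ∧ LocallyIntegrableOn (fun x => nl q (u x)) Ω := by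
  have h1 : LocallyIntegrableOn (fun x => |u x| ^ q) Ω :=
    (locallyIntegrableOn_iff hΩ.isLocallyClosed).2 h.2
  have h2 : LocallyIntegrableOn (fun _ : Eu N => (1 : ℝ)) Ω :=
    (locallyIntegrable_const 1).locallyIntegrableOn Ω
  refine ⟨locallyIntegrableOn_of_abs_le hΩ h.1 (h2.add h1) (ae_of_all _ fun x _ => ?_),
    locallyIntegrableOn_of_abs_le hΩ ((continuous_nl hq).comp_aestronglyMeasurable h.1) h1
      (ae_of_all _ fun x _ => (abs_nl hq _).le)⟩
  have h0 := abs_nonneg (u x)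
  simp only [Pi.add_apply]
  rcases le_total (|u x|) 1 with h | h
  · have := Real.rpow_nonneg h0 q
    linarith
  · have := Real.rpow_le_rpow_of_exponent_le h hq.le
    rw [Real.rpow_one] at this
    linarith

theorem setIntegral_weak_eq {N : ℕ} {q : ℝ} (hq : 1 < q) {Ω : Set (Eu N)} (hΩ : IsOpen Ω)
    {u φ : Eu N → ℝ} (hu : MemLqLoc q Ω u) (hφ : IsTestFun Ω φ) :
    ∫ x in Ω, (-(u x) * laplacian φ x + |u x| ^ (q - 1) * u x * φ x) =
      (∫ x, nl q (u x) * φ x) - ∫ x, u x * laplacian φ x := by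
  obtain ⟨h1, h2⟩ := hu.locallyIntegrableOn hq hΩ
  rw [setIntegral_eq_integral_of_forall_compl_eq_zero, ← integral_sub (hφ.integrable_mul h2)
    (hφ.integrable_mul_laplacian h1)]
  · refine integral_congr_ae (ae_of_all _ fun x => ?_)
    simp only [nl]
    ring
  · intro x hx
    rw [image_eq_zero_of_notMem_tsupport fun h => hx (hφ.2.2 h),
      image_eq_zero_of_notMem_tsupport fun h => hx (hφ.tsupport_laplacian h)]
    simp

/-- Nonnegative subsolutions lying below `u`. -/
def SubBelow {N : ℕ} (q : ℝ) (Ω : Set (Eu N)) (u v : Eu N → ℝ) : Prop :=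
  LapGE Ω v (fun x => nl q (v x)) ∧ (∀ᵐ x, x ∈ Ω → 0 ≤ v x) ∧ ∀ᵐ x, x ∈ Ω → v x ≤ u x

theorem nl_mul_maxWt (q s t : ℝ) :
    nl q s * maxWt (s - t) + nl q t * (1 - maxWt (s - t)) = nl q (max s t) := by
  rcases lt_trichotomy s t with h | rfl | h
  · rw [maxWt_of_neg (by linarith), max_eq_right h.le]; ring
  · rw [sub_self, max_self]; ring
  · rw [maxWt_of_pos (by linarith), max_eq_left h.le]; ring

theorem LapGE.max_nl {N : ℕ} {q : ℝ} {Ω : Set (Eu N)} (hΩ : IsOpen Ω) {v w : Eu N → ℝ}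
    (hv : LapGE Ω v (fun x => nl q (v x))) (hw : LapGE Ω w (fun x => nl q (w x))) :
    LapGE Ω (fun x => Max.max (v x) (w x)) (fun x => nl q (Max.max (v x) (w x))) := by
  have := hv.max hΩ hw
  simpa only [nl_mul_maxWt] using this

theorem SubBelow.max {N : ℕ} {q : ℝ} {Ω : Set (Eu N)} (hΩ : IsOpen Ω) {u v w : Eu N → ℝ}
    (hv : SubBelow q Ω u v) (hw : SubBelow q Ω u w) :
    SubBelow q Ω u (fun x => Max.max (v x) (w x)) := by
  refine ⟨hv.1.max_nl hΩ hw.1, ?_, ?_⟩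
  · filter_upwards [hv.2.1] with x hx hxΩ using le_max_of_le_left (hx hxΩ)
  · filter_upwards [hv.2.2, hw.2.2] with x hx hx' hxΩ using max_le (hx hxΩ) (hx' hxΩ)

theorem IsSolution.lapGE {N : ℕ} {q : ℝ} (hq : 1 < q) {Ω : Set (Eu N)} (hΩ : IsOpen Ω)
    {V : Eu N → ℝ} (hV : IsSolution q Ω V) : LapGE Ω V (fun x => nl q (V x)) := by
  obtain ⟨h1, h2⟩ := hV.1.locallyIntegrableOn hq hΩ
  refine ⟨h1, h2, fun φ hφ _ => ?_⟩
  have := hV.2 φ hφ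
  rw [setIntegral_weak_eq hq hΩ hV.1 hφ] at this
  linarith

theorem IsSupersolution.lapGE {N : ℕ} {q : ℝ} (hq : 1 < q) {Ω : Set (Eu N)} (hΩ : IsOpen Ω)
    {u : Eu N → ℝ} (hu : IsSupersolution q Ω u) :
    LapGE Ω (fun x => -u x) (fun x => -nl q (u x)) := by
  obtain ⟨h1, h2⟩ := hu.1.locallyIntegrableOn hq hΩ
  refine ⟨h1.neg, h2.neg, fun φ hφ h0 => ?_⟩
  have := hu.2 φ hφ h0
  rw [setIntegral_weak_eq hq hΩ hu.1 hφ] at this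
  simp only [neg_mul, integral_neg]
  linarith

theorem subBelow_zero {N : ℕ} (q : ℝ) {Ω : Set (Eu N)} {u : Eu N → ℝ}
    (hu : ∀ᵐ x, x ∈ Ω → 0 ≤ u x) : SubBelow q Ω u (fun _ => 0) := by
  refine ⟨?_, ae_of_all _ fun _ _ => le_rfl, hu⟩
  simpa only [nl_zero] using lapGE_zero Ω

theorem IsSolution.subBelow {N : ℕ} {q : ℝ} (hq : 1 < q) {Ω : Set (Eu N)} (hΩ : IsOpen Ω)
    {u V : Eu N → ℝ} (hu : ∀ᵐ x, x ∈ Ω → 0 ≤ u x) (hV : IsSolution q Ω V)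
    (h : ∀ᵐ x, x ∈ Ω → V x ≤ u x) : SubBelow q Ω u (fun x => Max.max (V x) 0) := by
  refine ⟨(hV.lapGE hq hΩ).max_nl hΩ (subBelow_zero q hu).1,
    ae_of_all _ fun _ _ => le_max_right _ _, ?_⟩
  filter_upwards [h, hu] with x hx hx' hxΩ using max_le (hx hxΩ) (hx' hxΩ)

theorem SubBelow.of_tendsto {N : ℕ} {q : ℝ} (hq : 1 < q) {Ω : Set (Eu N)} (hΩ : IsOpen Ω)
    {u w : Eu N → ℝ} {W : ℕ → Eu N → ℝ} (hu : LocallyIntegrableOn u Ω)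
    (hu' : LocallyIntegrableOn (fun x => nl q (u x)) Ω) (hW : ∀ n, SubBelow q Ω u (W n))
    (ht : ∀ᵐ x, x ∈ Ω → Tendsto (fun n => W n x) atTop (𝓝 (w x))) : SubBelow q Ω u w := by
  have hm : AEStronglyMeasurable w (volume.restrict Ω) :=
    aestronglyMeasurable_of_tendsto_ae atTop (fun n => (hW n).1.1.aestronglyMeasurable)
      ((ae_restrict_iff_of_isOpen hΩ).2 ht)
  have hnn : ∀ᵐ x, x ∈ Ω → ∀ n, 0 ≤ W n x := by
    filter_upwards [ae_all_iff.2 fun n => (hW n).2.1] with x hx hxΩ n using hx n hxΩ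
  have hle : ∀ᵐ x, x ∈ Ω → ∀ n, W n x ≤ u x := by
    filter_upwards [ae_all_iff.2 fun n => (hW n).2.2] with x hx hxΩ n using hx n hxΩ
  have h0 : ∀ᵐ x, x ∈ Ω → 0 ≤ w x := by
    filter_upwards [hnn, ht] with x hx ht hxΩ using ge_of_tendsto' (ht hxΩ) (hx hxΩ)
  have h1 : ∀ᵐ x, x ∈ Ω → w x ≤ u x := by
    filter_upwards [hle, ht] with x hx ht hxΩ using le_of_tendsto' (ht hxΩ) (hx hxΩ)
  have li : LocallyIntegrableOn w Ω := by
    refine locallyIntegrableOn_of_abs_le hΩ hm hu ?_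
    filter_upwards [h0, h1] with x h0 h1 hx
    rw [abs_of_nonneg (h0 hx)]; exact h1 hx
  have li' : LocallyIntegrableOn (fun x => nl q (w x)) Ω := by
    refine locallyIntegrableOn_of_abs_le hΩ ((continuous_nl hq).comp_aestronglyMeasurable hm) hu' ?_
    filter_upwards [h0, h1] with x h0 h1 hx
    rw [abs_of_nonneg (nl_nonneg hq (h0 hx))]; exact nl_le_nl hq (h0 hx) (h1 hx)
  refine ⟨⟨li, li', fun φ hφ hφ0 => ?_⟩, h0, h1⟩
  have t1 : Tendsto (fun n => ∫ x, nl q (W n x) * φ x) atTop (𝓝 (∫ x, nl q (w x) * φ x)) := by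
    refine tendsto_integral_of_dominated_convergence (fun x => |nl q (u x) * φ x|)
      (fun n => (hφ.integrable_mul (hW n).1.2.1).aestronglyMeasurable)
      (hφ.integrable_mul hu').abs (fun n => ?_) ?_
    · filter_upwards [hnn, hle] with x hx hx'
      by_cases hxΩ : x ∈ Ω
      · rw [norm_mul, abs_mul]
        refine mul_le_mul_of_nonneg_right ?_ (abs_nonneg _)
        have := nl_nonneg hq (hx hxΩ n)
        rw [Real.norm_of_nonneg this]
        exact (nl_le_nl hq (hx hxΩ n) (hx' hxΩ n)).trans (le_abs_self _)
      · simp [image_eq_zero_of_notMem_tsupport fun h => hxΩ (hφ.2.2 h)]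
    · filter_upwards [ht] with x hx
      by_cases hxΩ : x ∈ Ω
      · exact (((continuous_nl hq).tendsto _).comp (hx hxΩ)).mul_const _
      · simp [image_eq_zero_of_notMem_tsupport fun h => hxΩ (hφ.2.2 h)]
  have t2 : Tendsto (fun n => ∫ x, W n x * laplacian φ x) atTop
      (𝓝 (∫ x, w x * laplacian φ x)) := by
    refine tendsto_integral_of_dominated_convergence (fun x => |u x * laplacian φ x|)
      (fun n => (hφ.integrable_mul_laplacian (hW n).1.1).aestronglyMeasurable)
      (hφ.integrable_mul_laplacian hu).abs (fun n => ?_) ?_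
    · filter_upwards [hnn, hle] with x hx hx'
      by_cases hxΩ : x ∈ Ω
      · rw [norm_mul, abs_mul]
        refine mul_le_mul_of_nonneg_right ?_ (abs_nonneg _)
        rw [Real.norm_of_nonneg (hx hxΩ n)]
        exact (hx' hxΩ n).trans (le_abs_self _)
      · simp [image_eq_zero_of_notMem_tsupport fun h => hxΩ (hφ.tsupport_laplacian h)]
    · filter_upwards [ht] with x hx
      by_cases hxΩ : x ∈ Ω
      · exact (hx hxΩ).mul_const _
      · simp [image_eq_zero_of_notMem_tsupport fun h => hxΩ (hφ.tsupport_laplacian h)]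
  exact le_of_tendsto_of_tendsto' t1 t2 fun n => (hW n).1.2.2 φ hφ hφ0

theorem exists_maximal_subBelow {N : ℕ} {q : ℝ} (hq : 1 < q) {Ω : Set (Eu N)} (hΩ : IsOpen Ω)
    (hb : Bornology.IsBounded Ω) {u : Eu N → ℝ} (hu : LocallyIntegrableOn u Ω)
    (hu' : LocallyIntegrableOn (fun x => nl q (u x)) Ω) (h0 : ∀ᵐ x, x ∈ Ω → 0 ≤ u x) :
    ∃ w, SubBelow q Ω u w ∧ ∀ v, SubBelow q Ω u v → ∀ᵐ x, x ∈ Ω → v x ≤ w x := by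
  have : IsFiniteMeasure (volume.restrict Ω) := ⟨by simpa using hb.measure_lt_top⟩
  set J : (Eu N → ℝ) → ℝ := fun v => ∫ x in Ω, Real.arctan (v x) with hJ
  have hi : ∀ v, SubBelow q Ω u v → Integrable (fun x => Real.arctan (v x)) (volume.restrict Ω) := by
    intro v hv
    refine Integrable.of_bound
      (Real.continuous_arctan.comp_aestronglyMeasurable hv.1.1.aestronglyMeasurable) (Real.pi / 2)
      (ae_of_all _ fun x => ?_)
    exact abs_le.2 ⟨(Real.neg_pi_div_two_lt_arctan _).le, (Real.arctan_lt_pi_div_two _).le⟩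
  have hmono : ∀ v v', SubBelow q Ω u v → SubBelow q Ω u v' → (∀ᵐ x, x ∈ Ω → v x ≤ v' x) →
      J v ≤ J v' := by
    intro v v' hv hv' h
    refine integral_mono_ae (hi v hv) (hi v' hv') ((ae_restrict_iff_of_isOpen hΩ).2 ?_)
    filter_upwards [h] with x hx hxΩ using Real.arctan_mono (hx hxΩ)
  set T : Set ℝ := J '' {v | SubBelow q Ω u v} with hT
  have hne : T.Nonempty := ⟨_, _, subBelow_zero q h0, rfl⟩
  have hbd : BddAbove T := by
    refine ⟨∫ x in Ω, Real.pi / 2, ?_⟩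
    rintro _ ⟨v, hv, rfl⟩
    exact integral_mono (hi v hv) (integrable_const _) fun x => (Real.arctan_lt_pi_div_two _).le
  obtain ⟨t, -, ht, htT⟩ := exists_seq_tendsto_sSup hne hbd
  choose v hv hvt using htT
  let W : ℕ → Eu N → ℝ := fun n => Nat.rec (v 0) (fun n W x => Max.max (W x) (v (n + 1) x)) n
  have hWs : ∀ n, W (n + 1) = fun x => Max.max (W n x) (v (n + 1) x) := fun n => rfl
  have hW : ∀ n, SubBelow q Ω u (W n) := by
    intro n
    induction n with
    | zero => exact hv 0
    | succ n ih => rw [hWs]; exact ih.max hΩ (hv _)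
  have hvW : ∀ n x, v n x ≤ W n x := by
    intro n x
    cases n with
    | zero => exact le_rfl
    | succ n => rw [hWs]; exact le_max_right _ _
  have hWm : ∀ x, Monotone fun n => W n x := fun x =>
    monotone_nat_of_le_succ fun n => by rw [hWs]; exact le_max_left _ _
  set w : Eu N → ℝ := fun x => ⨆ n, W n x with hw
  have hle : ∀ᵐ x, x ∈ Ω → ∀ n, W n x ≤ u x := by
    filter_upwards [ae_all_iff.2 fun n => (hW n).2.2] with x hx hxΩ n using hx n hxΩ
  have hbdd : ∀ᵐ x, x ∈ Ω → BddAbove (range fun n => W n x) := by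
    filter_upwards [hle] with x hx hxΩ
    exact ⟨u x, by rintro _ ⟨n, rfl⟩; exact hx hxΩ n⟩
  have hwS : SubBelow q Ω u w := by
    refine SubBelow.of_tendsto hq hΩ hu hu' hW ?_
    filter_upwards [hbdd] with x hx hxΩ using tendsto_atTop_ciSup (hWm x) (hx hxΩ)
  have hJw : sSup T ≤ J w := by
    refine le_of_tendsto' ht fun n => ?_
    rw [← hvt n]
    refine hmono _ _ (hv n) hwS ?_
    filter_upwards [hbdd] with x hx hxΩ using (hvW n x).trans (le_ciSup (hx hxΩ) n)
  refine ⟨w, hwS, fun z hz => ?_⟩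
  have hM := hwS.max hΩ hz
  have h1 : J (fun x => Max.max (w x) (z x)) ≤ J w := (le_csSup hbd ⟨_, hM, rfl⟩).trans hJw
  have h2 : ∫ x in Ω, (Real.arctan (Max.max (w x) (z x)) - Real.arctan (w x)) ≤ 0 := by
    rw [integral_sub (hi _ hM) (hi _ hwS)]
    linarith
  have hnn : ∀ x, 0 ≤ Real.arctan (Max.max (w x) (z x)) - Real.arctan (w x) := fun x =>
    sub_nonneg.2 (Real.arctan_mono (le_max_left _ _))
  have h3 := (integral_eq_zero_iff_of_nonneg hnn ((hi _ hM).sub (hi _ hwS))).1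
    (le_antisymm h2 (integral_nonneg hnn))
  filter_upwards [(ae_restrict_iff_of_isOpen hΩ).1 h3] with x hx hxΩ
  have h4 := Real.arctan_injective (sub_eq_zero.1 (hx hxΩ))
  rw [← h4]; exact le_max_right _ _

/-- A smooth radial weight supported in the unit ball. -/
def radWt (N : ℕ) (z : Eu N) : ℝ := expNegInvGlue (1 - ‖z‖ ^ 2)

/-- The companion of `radWt`, satisfying `∇ (radWt N) z = -radWt' N z • z`. -/
def radWt' (N : ℕ) (z : Eu N) : ℝ := 2 * ((1 - ‖z‖ ^ 2)⁻¹ ^ 2 * expNegInvGlue (1 - ‖z‖ ^ 2))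

theorem contDiff_radWt (N : ℕ) : ContDiff ℝ ∞ (radWt N) :=
  (expNegInvGlue.contDiff (n := ⊤)).comp (contDiff_const.sub (contDiff_norm_sq ℝ))

theorem continuous_radWt' (N : ℕ) : Continuous (radWt' N) := by
  have h := expNegInvGlue.continuous_polynomial_eval_inv_mul (Polynomial.X ^ 2)
  simp only [Polynomial.eval_pow, Polynomial.eval_X] at h
  exact continuous_const.mul (h.comp (continuous_const.sub (continuous_norm.pow 2)))

theorem radWt_nonneg (N : ℕ) (z : Eu N) : 0 ≤ radWt N z := expNegInvGlue.nonneg _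

theorem radWt_le (N : ℕ) (z : Eu N) : 2 * radWt N z ≤ radWt' N z := by
  rw [radWt, radWt']
  refine mul_le_mul_of_nonneg_left ?_ zero_le_two
  rcases le_or_gt (1 - ‖z‖ ^ 2) 0 with h | h
  · rw [expNegInvGlue.zero_of_nonpos h, mul_zero]
  · refine le_mul_of_one_le_left (expNegInvGlue.nonneg _) (one_le_pow₀ ?_)
    exact (one_le_inv₀ h).2 (by nlinarith [sq_nonneg ‖z‖])

theorem radWt'_nonneg (N : ℕ) (z : Eu N) : 0 ≤ radWt' N z := by
  linarith [radWt_le N z, radWt_nonneg N z]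

theorem radWt_eq_zero {N : ℕ} {z : Eu N} (h : 1 < ‖z‖) : expNegInvGlue (1 - ‖z‖ ^ 2) = 0 :=
  expNegInvGlue.zero_of_nonpos (by nlinarith)

theorem hasCompactSupport_radWt (N : ℕ) : HasCompactSupport (radWt N) :=
  HasCompactSupport.intro (isCompact_closedBall 0 1) fun z hz => by
    rw [radWt, radWt_eq_zero]; simpa using hz

theorem hasCompactSupport_radWt' (N : ℕ) : HasCompactSupport (radWt' N) :=
  HasCompactSupport.intro (isCompact_closedBall 0 1) fun z hz => by
    rw [radWt', radWt_eq_zero, mul_zero, mul_zero]; simpa using hz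

theorem pd_radWt {N : ℕ} (i : Fin N) (z : Eu N) : pd i (radWt N) z = -(z i * radWt' N z) := by
  have h1 := expNegInvGlue.hasDerivAt_polynomial_eval_inv_mul 1 (1 - ‖z‖ ^ 2)
  simp only [Polynomial.eval_one, one_mul, Polynomial.derivative_one, sub_zero, mul_one,
    Polynomial.eval_pow, Polynomial.eval_X] at h1
  have h2 := (hasStrictFDerivAt_norm_sq (F := Eu N) z).hasFDerivAt.const_sub 1
  have h3 : HasFDerivAt (radWt N) _ z := h1.comp_hasFDerivAt z h2
  rw [pd, h3.fderiv, radWt']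
  simp [EuclideanSpace.inner_single_right]
  ring

theorem fderiv_apply_eq_sum_pd {N : ℕ} (φ : Eu N → ℝ) (x z : Eu N) :
    fderiv ℝ φ x z = ∑ i, z i * pd i φ x := by
  have h : z = ∑ i, z i • EuclideanSpace.single i (1 : ℝ) := by
    have := (EuclideanSpace.basisFun (Fin N) ℝ).sum_repr z
    simpa using this.symm
  conv_lhs => rw [h]
  rw [map_sum]
  exact Finset.sum_congr rfl fun i _ => by rw [map_smul, smul_eq_mul, pd]

theorem hasDerivAt_integral_mul_comp_smul {N : ℕ} {k φ : Eu N → ℝ} (hk : Continuous k)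
    (hkc : HasCompactSupport k) (h : ContDiff ℝ ∞ φ) (hc : HasCompactSupport φ) (t : ℝ) :
    HasDerivAt (fun t : ℝ => ∫ z, k z * φ (t • z)) (∫ z, k z * fderiv ℝ φ (t • z) z) t := by
  have hd : Continuous (fderiv ℝ φ) := h.continuous_fderiv (by simp)
  obtain ⟨C, hC⟩ := (hc.fderiv (𝕜 := ℝ)).exists_bound_of_continuous hd
  have hF : ∀ t : ℝ, Continuous fun z => k z * φ (t • z) := fun t =>
    hk.mul (h.continuous.comp (continuous_const_smul t))
  have hF' : Continuous fun z => k z * fderiv ℝ φ (t • z) z :=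
    hk.mul ((hd.comp (continuous_const_smul t)).clm_apply continuous_id)
  refine (hasDerivAt_integral_of_dominated_loc_of_deriv_le (𝕜 := ℝ) (s := univ)
    (F := fun t z => k z * φ (t • z)) (F' := fun t z => k z * fderiv ℝ φ (t • z) z)
    (bound := fun z => |k z| * (C * ‖z‖)) univ_mem
    (Eventually.of_forall fun t => (hF t).aestronglyMeasurable)
    ((hF t).integrable_of_hasCompactSupport hkc.mul_right) hF'.aestronglyMeasurable
    (ae_of_all _ fun z t _ => ?_) ?_ (ae_of_all _ fun z t _ => ?_)).2
  · rw [norm_mul]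
    refine mul_le_mul_of_nonneg_left ?_ (abs_nonneg _)
    exact (ContinuousLinearMap.le_opNorm _ _).trans
      (mul_le_mul_of_nonneg_right (hC _) (norm_nonneg _))
  · have : HasCompactSupport fun z => |k z| := hkc.comp_left (g := fun t : ℝ => |t|) abs_zero
    exact (hk.abs.mul (continuous_const.mul continuous_norm)).integrable_of_hasCompactSupport
      this.mul_right
  · have h1 : HasDerivAt (fun t : ℝ => t • z) z t := by
      simpa using (hasDerivAt_id t).smul_const z
    have h2 := ((h.differentiable (by simp)) (t • z)).hasFDerivAt.comp_hasDerivAt t h1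
    exact h2.const_mul (k z)

theorem pd_comp_smul {N : ℕ} {φ : Eu N → ℝ} (h : ContDiff ℝ ∞ φ) (t : ℝ) (i : Fin N) (z : Eu N) :
    pd i (fun z => φ (t • z)) z = t * pd i φ (t • z) := by
  have h1 : HasFDerivAt (fun z : Eu N => t • z) (t • ContinuousLinearMap.id ℝ (Eu N)) z :=
    (hasFDerivAt_id z).const_smul t
  have h2 := ((h.differentiable (by simp)) (t • z)).hasFDerivAt.comp z h1
  rw [pd, HasFDerivAt.fderiv (f := fun z => φ (t • z)) h2]
  simp [pd]

theorem integral_radWt'_mul_fderiv {N : ℕ} {φ : Eu N → ℝ} (h : ContDiff ℝ ∞ φ) (t : ℝ) :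
    ∫ z, radWt' N z * fderiv ℝ φ (t • z) z = t * ∫ z, radWt N z * laplacian φ (t • z) := by
  have hs : ContDiff ℝ ∞ (fun z : Eu N => t • z) := contDiff_const_smul t
  have i1 : ∀ i : Fin N, Integrable fun z => radWt' N z * (z i * pd i φ (t • z)) := fun i => by
    refine Continuous.integrable_of_hasCompactSupport ?_ (hasCompactSupport_radWt' N).mul_right
    have := (h.pd i).continuous
    have := continuous_radWt' N
    fun_prop
  have i2 : ∀ i : Fin N, Integrable fun z => radWt N z * pd i (pd i φ) (t • z) := fun i => by
    refine Continuous.integrable_of_hasCompactSupport ?_ (hasCompactSupport_radWt N).mul_right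
    have := ((h.pd i).pd i).continuous
    have := (contDiff_radWt N).continuous
    fun_prop
  simp_rw [fderiv_apply_eq_sum_pd, laplacian_eq_sum_pd h, Finset.mul_sum]
  rw [integral_finsetSum _ fun i _ => i1 i, integral_finsetSum _ fun i _ => i2 i, Finset.mul_sum]
  refine Finset.sum_congr rfl fun i _ => ?_
  have key := integral_mul_pd ((h.pd i).comp hs) (contDiff_radWt N) (hasCompactSupport_radWt N) i
  have e : ∀ z, pd i (pd i φ ∘ fun z => t • z) z = t * pd i (pd i φ) (t • z) :=
    fun z => pd_comp_smul (h.pd i) t i z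
  simp only [e, pd_radWt, Function.comp_apply] at key
  rw [← integral_const_mul]
  calc ∫ z, radWt' N z * (z i * pd i φ (t • z))
      = -∫ z, pd i φ (t • z) * -(z i * radWt' N z) := by
        rw [← integral_neg]; congr 1; funext z; ring
    _ = _ := by rw [key, neg_neg]; congr 1; funext z; ring

/-- The damping factor in the radial kernel. -/
def damp (L t : ℝ) : ℝ := Real.exp (-(L * t ^ 2 / 4))

theorem hasDerivAt_damp (L t : ℝ) : HasDerivAt (damp L) (-(L / 2 * t) * damp L t) t := by
  have : HasDerivAt (fun t : ℝ => -(L * t ^ 2 / 4)) (-(L / 2 * t)) t := by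
    exact (((hasDerivAt_pow 2 t).const_mul L).div_const 4).neg.congr_deriv (by norm_num; ring)
  rw [mul_comm]
  exact this.exp

theorem continuous_damp (L : ℝ) : Continuous (damp L) := by unfold damp; fun_prop

theorem damp_pos (L t : ℝ) : 0 < damp L t := Real.exp_pos _

theorem damp_zero (L : ℝ) : damp L 0 = 1 := by simp [damp]

theorem damp_le_one {L : ℝ} (hL : 0 ≤ L) (t : ℝ) : damp L t ≤ 1 :=
  Real.exp_le_one_iff.2 (by have := mul_nonneg hL (sq_nonneg t); linarith)

theorem radial_identity {N : ℕ} {φ : Eu N → ℝ} (h : ContDiff ℝ ∞ φ) (hc : HasCompactSupport φ)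
    (L ε : ℝ) :
    ∫ t in (0 : ℝ)..ε, damp L t * t * ∫ z, radWt N z * laplacian φ (t • z) =
      damp L ε * (∫ z, radWt' N z * φ (ε • z)) - (∫ z, radWt' N z) * φ 0 +
        L / 2 * ∫ t in (0 : ℝ)..ε, damp L t * t * ∫ z, radWt' N z * φ (t • z) := by
  have hA := hasDerivAt_integral_mul_comp_smul (continuous_radWt' N) (hasCompactSupport_radWt' N) h hc
  have hB := hasDerivAt_integral_mul_comp_smul (contDiff_radWt N).continuous
    (hasCompactSupport_radWt N) h.laplacian (hc.laplacian h)
  simp_rw [integral_radWt'_mul_fderiv h] at hA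
  set A : ℝ → ℝ := fun t => ∫ z, radWt' N z * φ (t • z) with hAdef
  set B : ℝ → ℝ := fun t => ∫ z, radWt N z * laplacian φ (t • z) with hBdef
  have cA : Continuous A := continuous_iff_continuousAt.2 fun t => (hA t).continuousAt
  have cB : Continuous B := continuous_iff_continuousAt.2 fun t => (hB t).continuousAt
  have cd := continuous_damp L
  have hG : ∀ t, HasDerivAt (fun t => damp L t * A t)
      (damp L t * t * B t - L / 2 * (damp L t * t * A t)) t := fun t =>
    ((hasDerivAt_damp L t).mul (hA t)).congr_deriv (by simp only [hBdef, hAdef]; ring)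
  have key := intervalIntegral.integral_eq_sub_of_hasDerivAt (a := 0) (b := ε) (fun t _ => hG t)
    (Continuous.intervalIntegrable (by fun_prop) _ _)
  rw [intervalIntegral.integral_sub (Continuous.intervalIntegrable (by fun_prop) _ _)
    (Continuous.intervalIntegrable (by fun_prop) _ _), intervalIntegral.integral_const_mul] at key
  have e0 : A 0 = (∫ z, radWt' N z) * φ 0 := by
    simp only [hAdef, zero_smul, integral_mul_const]
  rw [damp_zero, e0] at key
  linarith

/-- The law of `t • z`, where `t ∈ (0, ε]` has density `damp L t * t` and `z` has density
`radWt N z`. -/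
def radMeas (N : ℕ) (L ε : ℝ) : Measure (Eu N) :=
  (((volume.restrict (Ioc 0 ε)).withDensity fun t => ENNReal.ofReal (damp L t * t)).prod
    (volume.withDensity fun z => ENNReal.ofReal (radWt N z))).map fun p : ℝ × Eu N => p.1 • p.2

instance isFiniteMeasure_damp (L ε : ℝ) : IsFiniteMeasure
    ((volume.restrict (Ioc 0 ε)).withDensity fun t => ENNReal.ofReal (damp L t * t)) :=
  isFiniteMeasure_withDensity_ofReal
    (((continuous_damp L).mul continuous_id).integrableOn_Ioc (a := 0) (b := ε)).2

instance isFiniteMeasure_radWt (N : ℕ) : IsFiniteMeasure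
    ((volume : Measure (Eu N)).withDensity fun z => ENNReal.ofReal (radWt N z)) :=
  isFiniteMeasure_withDensity_ofReal
    ((contDiff_radWt N).continuous.integrable_of_hasCompactSupport (hasCompactSupport_radWt N)).2

instance isFiniteMeasure_radMeas (N : ℕ) (L ε : ℝ) : IsFiniteMeasure (radMeas N L ε) := by
  unfold radMeas; infer_instance

theorem integral_radMeas {N : ℕ} {f : Eu N → ℝ} (hf : Continuous f) {C : ℝ} (hC : ∀ x, |f x| ≤ C)
    (L : ℝ) {ε : ℝ} (hε : 0 ≤ ε) :
    ∫ y, f y ∂(radMeas N L ε) =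
      ∫ t in (0 : ℝ)..ε, damp L t * t * ∫ z, radWt N z * f (t • z) := by
  have hm : Continuous fun p : ℝ × Eu N => p.1 • p.2 := continuous_fst.smul continuous_snd
  rw [radMeas, integral_map hm.aemeasurable hf.aestronglyMeasurable,
    integral_prod (fun p : ℝ × Eu N => f (p.1 • p.2)) (Integrable.of_bound (hf.comp hm).aestronglyMeasurable C
      (ae_of_all _ fun p => hC _)),
    integral_withDensity_eq_integral_toReal_smul
      (f := fun t => ENNReal.ofReal (damp L t * t))
      (((continuous_damp L).mul continuous_id).measurable.ennreal_ofReal)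
      (ae_of_all _ fun _ => ENNReal.ofReal_lt_top),
    intervalIntegral.integral_of_le hε]
  refine setIntegral_congr_fun measurableSet_Ioc fun t ht => ?_
  simp only [smul_eq_mul]
  rw [ENNReal.toReal_ofReal (mul_nonneg (damp_pos L t).le ht.1.le),
    integral_withDensity_eq_integral_toReal_smul
      ((contDiff_radWt N).continuous.measurable.ennreal_ofReal)
      (ae_of_all _ fun _ => ENNReal.ofReal_lt_top)]
  congr 1
  refine integral_congr_ae (ae_of_all _ fun z => ?_)
  simp only [smul_eq_mul]
  rw [ENNReal.toReal_ofReal (radWt_nonneg N z)]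

theorem ae_norm_le_radMeas (N : ℕ) (L ε : ℝ) : ∀ᵐ y ∂(radMeas N L ε), ‖y‖ ≤ ε := by
  have hm : Continuous fun p : ℝ × Eu N => p.1 • p.2 := continuous_fst.smul continuous_snd
  rw [radMeas, ae_map_iff hm.aemeasurable (measurableSet_le measurable_norm measurable_const)]
  have h1 : ∀ᵐ t ∂((volume.restrict (Ioc 0 ε)).withDensity fun t => ENNReal.ofReal (damp L t * t)),
      t ∈ Ioc 0 ε :=
    (withDensity_absolutelyContinuous _ _).ae_le (ae_restrict_mem measurableSet_Ioc)
  have h2 : ∀ᵐ z ∂((volume : Measure (Eu N)).withDensity fun z => ENNReal.ofReal (radWt N z)),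
      ‖z‖ ≤ 1 := by
    rw [ae_withDensity_iff (contDiff_radWt N).continuous.measurable.ennreal_ofReal]
    refine ae_of_all _ fun z hz => ?_
    by_contra! hlt
    exact hz (by rw [radWt, radWt_eq_zero hlt, ENNReal.ofReal_zero])
  filter_upwards [Measure.quasiMeasurePreserving_fst.ae h1,
    Measure.quasiMeasurePreserving_snd.ae h2] with p hp1 hp2
  rw [norm_smul, Real.norm_of_nonneg hp1.1.le]
  nlinarith [hp1.1, hp1.2, norm_nonneg p.2]

theorem integral_radWt_pos (N : ℕ) : 0 < ∫ z, radWt N z := by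
  refine (contDiff_radWt N).continuous.integral_pos_of_hasCompactSupport_nonneg_nonzero
    (hasCompactSupport_radWt N) (radWt_nonneg N) (x := 0) ?_
  rw [radWt]
  exact (expNegInvGlue.pos_of_pos (by simp)).ne'

theorem radMeas_univ_pos (N : ℕ) (L : ℝ) {ε : ℝ} (hε : 0 < ε) :
    0 < (radMeas N L ε).real univ := by
  have h := integral_radMeas (N := N) (f := fun _ => 1) continuous_const (C := 1) (by simp) L hε.le
  rw [integral_const, smul_eq_mul, mul_one] at h
  rw [h]
  refine intervalIntegral.intervalIntegral_pos_of_pos_on ?_ (fun t ht => ?_) hε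
  · exact Continuous.intervalIntegrable
      (((continuous_damp L).mul continuous_id).mul continuous_const) _ _
  · simp only [mul_one]
    exact mul_pos (mul_pos (damp_pos L t) ht.1) (integral_radWt_pos N)

theorem continuous_integral_mul_comp_smul {N : ℕ} {k φ : Eu N → ℝ} (hk : Continuous k)
    (hkc : HasCompactSupport k) (h : ContDiff ℝ ∞ φ) (hc : HasCompactSupport φ) :
    Continuous fun t : ℝ => ∫ z, k z * φ (t • z) :=
  continuous_iff_continuousAt.2 fun t =>
    (hasDerivAt_integral_mul_comp_smul hk hkc h hc t).continuousAt

theorem integrable_radWt'_mul {N : ℕ} {f : Eu N → ℝ} (hf : Continuous f) (t : ℝ) :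
    Integrable fun z => radWt' N z * f (t • z) :=
  ((continuous_radWt' N).mul (hf.comp (continuous_const_smul t))).integrable_of_hasCompactSupport
    (hasCompactSupport_radWt' N).mul_right

theorem integrable_radWt_mul {N : ℕ} {f : Eu N → ℝ} (hf : Continuous f) (t : ℝ) :
    Integrable fun z => radWt N z * f (t • z) :=
  ((contDiff_radWt N).continuous.mul
    (hf.comp (continuous_const_smul t))).integrable_of_hasCompactSupport
    (hasCompactSupport_radWt N).mul_right

theorem integral_radWt'_pos (N : ℕ) : 0 < ∫ z, radWt' N z := by
  have h1 : Integrable (radWt N) := (contDiff_radWt N).continuous.integrable_of_hasCompactSupport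
    (hasCompactSupport_radWt N)
  have h2 : Integrable (radWt' N) := (continuous_radWt' N).integrable_of_hasCompactSupport
    (hasCompactSupport_radWt' N)
  have h := integral_mono (h1.const_mul 2) h2 (radWt_le N)
  rw [integral_const_mul] at h
  linarith [integral_radWt_pos N]

/-- A lower bound for `Δ φ` averaged against `radMeas`. -/
theorem le_integral_laplacian_radMeas {N : ℕ} {φ : Eu N → ℝ} (h : ContDiff ℝ ∞ φ)
    (hc : HasCompactSupport φ) (h0 : ∀ x, 0 ≤ φ x) {L ε : ℝ} (hL : 0 ≤ L) (hε : 0 ≤ ε)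
    (x : Eu N) :
    -(∫ z, radWt' N z) * φ x + L * ∫ y, φ (x + y) ∂(radMeas N L ε) ≤
      ∫ y, laplacian φ (x + y) ∂(radMeas N L ε) := by
  have hs : ContDiff ℝ ∞ fun y : Eu N => φ (x + y) := h.comp (contDiff_const.add contDiff_id)
  have hsc : HasCompactSupport fun y : Eu N => φ (x + y) :=
    hc.comp_homeomorph (Homeomorph.addLeft x)
  obtain ⟨C, hC⟩ := exists_abs_le_of_hasCompactSupport hs.continuous hsc
  obtain ⟨C', hC'⟩ := exists_abs_le_of_hasCompactSupport hs.laplacian.continuous (hsc.laplacian hs)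
  simp_rw [← laplacian_comp_const_add h]
  rw [integral_radMeas hs.laplacian.continuous hC' L hε, integral_radMeas hs.continuous hC L hε,
    radial_identity hs hsc]
  have cA := continuous_integral_mul_comp_smul (continuous_radWt' N) (hasCompactSupport_radWt' N)
    hs hsc
  have cB := continuous_integral_mul_comp_smul (contDiff_radWt N).continuous
    (hasCompactSupport_radWt N) hs hsc
  have cd := continuous_damp L
  have h1 : 0 ≤ damp L ε * ∫ z, radWt' N z * φ (x + ε • z) :=
    mul_nonneg (damp_pos L ε).le
      (integral_nonneg fun z => mul_nonneg (radWt'_nonneg N z) (h0 _))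
  have h2 : L * ∫ t in (0 : ℝ)..ε, damp L t * t * ∫ z, radWt N z * φ (x + t • z) ≤
      L / 2 * ∫ t in (0 : ℝ)..ε, damp L t * t * ∫ z, radWt' N z * φ (x + t • z) := by
    have : ∫ t in (0 : ℝ)..ε, 2 * (damp L t * t * ∫ z, radWt N z * φ (x + t • z)) ≤
        ∫ t in (0 : ℝ)..ε, damp L t * t * ∫ z, radWt' N z * φ (x + t • z) := by
      refine intervalIntegral.integral_mono_on hε
        (Continuous.intervalIntegrable (by fun_prop) _ _)
        (Continuous.intervalIntegrable (by fun_prop) _ _) fun t ht => ?_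
      have : 2 * ∫ z, radWt N z * φ (x + t • z) ≤ ∫ z, radWt' N z * φ (x + t • z) := by
        rw [← integral_const_mul]
        refine integral_mono ((integrable_radWt_mul hs.continuous t).const_mul 2)
          (integrable_radWt'_mul hs.continuous t) fun z => ?_
        simp only [← mul_assoc]
        exact mul_le_mul_of_nonneg_right (radWt_le N z) (h0 _)
      have := mul_le_mul_of_nonneg_left this (mul_nonneg (damp_pos L t).le ht.1)
      linarith
    rw [intervalIntegral.integral_const_mul] at this
    nlinarith
  simp only [add_zero] at *
  linarith

/-- An upper bound for `Δ φ` averaged against `radMeas`. -/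
theorem integral_laplacian_radMeas_le {N : ℕ} {φ : Eu N → ℝ} (h : ContDiff ℝ ∞ φ)
    (hc : HasCompactSupport φ) {M : ℝ} (hM : ∀ x, |φ x| ≤ M) {L ε : ℝ} (hL : 0 ≤ L) (hε : 0 ≤ ε)
    (x : Eu N) :
    ∫ y, laplacian φ (x + y) ∂(radMeas N L ε) ≤ (∫ z, radWt' N z) * (2 + L / 2 * ε ^ 2) * M := by
  have hs : ContDiff ℝ ∞ fun y : Eu N => φ (x + y) := h.comp (contDiff_const.add contDiff_id)
  have hsc : HasCompactSupport fun y : Eu N => φ (x + y) :=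
    hc.comp_homeomorph (Homeomorph.addLeft x)
  obtain ⟨C', hC'⟩ := exists_abs_le_of_hasCompactSupport hs.laplacian.continuous (hsc.laplacian hs)
  simp_rw [← laplacian_comp_const_add h]
  rw [integral_radMeas hs.laplacian.continuous hC' L hε, radial_identity hs hsc]
  have cA := continuous_integral_mul_comp_smul (continuous_radWt' N) (hasCompactSupport_radWt' N)
    hs hsc
  have cd := continuous_damp L
  have hρ := (integral_radWt'_pos N).le
  have hM0 : 0 ≤ M := (abs_nonneg _).trans (hM 0)
  have hi : ∀ t : ℝ, ∫ z, radWt' N z * φ (x + t • z) ≤ (∫ z, radWt' N z) * M := fun t => by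
    rw [← integral_mul_const]
    exact integral_mono (integrable_radWt'_mul hs.continuous t)
      (((continuous_radWt' N).integrable_of_hasCompactSupport
        (hasCompactSupport_radWt' N)).mul_const M) fun z =>
      mul_le_mul_of_nonneg_left ((le_abs_self _).trans (hM _)) (radWt'_nonneg N z)
  have hR := mul_nonneg hρ hM0
  have h1 : damp L ε * ∫ z, radWt' N z * φ (x + ε • z) ≤ (∫ z, radWt' N z) * M :=
    (mul_le_mul_of_nonneg_left (hi ε) (damp_pos L ε).le).trans
      (mul_le_of_le_one_left hR (damp_le_one hL ε))
  have h2 : -((∫ z, radWt' N z) * φ x) ≤ (∫ z, radWt' N z) * M := by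
    rw [← mul_neg]
    exact mul_le_mul_of_nonneg_left ((neg_le_abs _).trans (hM x)) hρ
  have h3 : ∫ t in (0 : ℝ)..ε, damp L t * t * ∫ z, radWt' N z * φ (x + t • z) ≤
      ∫ t in (0 : ℝ)..ε, ε * ((∫ z, radWt' N z) * M) := by
    refine intervalIntegral.integral_mono_on hε
        (Continuous.intervalIntegrable (by fun_prop) _ _)
        (Continuous.intervalIntegrable (by fun_prop) _ _) fun t ht => ?_
    have h4 : damp L t * t ≤ ε := (mul_le_of_le_one_left ht.1 (damp_le_one hL t)).trans ht.2
    exact (mul_le_mul_of_nonneg_left (hi t) (mul_nonneg (damp_pos L t).le ht.1)).trans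
      (mul_le_mul_of_nonneg_right h4 hR)
  rw [intervalIntegral.integral_const, smul_eq_mul, sub_zero] at h3
  have h5 := mul_le_mul_of_nonneg_left h3 (div_nonneg hL zero_le_two)
  simp only [add_zero] at *
  nlinarith

/-- Weak compactness of bounded sequences of nonnegative functions with a common compact
support. -/
theorem exists_weak_limit {N : ℕ} {K : Set (Eu N)} (hK : IsCompact K) {h : ℕ → Eu N → ℝ} {B : ℝ}
    (hc : ∀ n, Continuous (h n)) (h0 : ∀ n x, 0 ≤ h n x) (hB : ∀ n x, h n x ≤ B)
    (hs : ∀ n x, x ∉ K → h n x = 0) :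
    ∃ (g : Eu N → ℝ) (F : Filter ℕ), F.NeBot ∧ F ≤ atTop ∧ Integrable g ∧ (∀ x, 0 ≤ g x) ∧
      (∀ x, x ∉ K → g x = 0) ∧ ∀ ψ : Eu N → ℝ, Continuous ψ →
        Tendsto (fun n => ∫ x, h n x * ψ x) F (𝓝 (∫ x, g x * ψ x)) := by
  set μ : Measure (Eu N) := volume.restrict K with hμ
  have : IsFiniteMeasure μ := ⟨by simpa [hμ] using hK.measure_lt_top⟩
  have hm : ∀ n, MemLp (h n) 2 μ := fun n =>
    MemLp.of_bound (hc n).aestronglyMeasurable B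
      (ae_of_all _ fun x => by rw [Real.norm_of_nonneg (h0 n x)]; exact hB n x)
  set H : ℕ → Lp ℝ 2 μ := fun n => (hm n).toLp (h n) with hH
  obtain ⟨R, hR⟩ : ∃ R, ∀ n, ‖H n‖ ≤ R := by
    refine ⟨_, fun n => Lp.norm_le_of_ae_bound (C := B) ((h0 0 0).trans (hB 0 0)) ?_⟩
    filter_upwards [(hm n).coeFn_toLp] with x hx
    rw [hx, Real.norm_of_nonneg (h0 n x)]
    exact hB n x
  set D : ℕ → WeakDual ℝ (Lp ℝ 2 μ) := fun n =>
    StrongDual.toWeakDual (InnerProductSpace.toDual ℝ _ (H n)) with hD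
  have hDm : ∀ n, D n ∈ WeakDual.toStrongDual ⁻¹' Metric.closedBall (0 : StrongDual ℝ (Lp ℝ 2 μ)) R :=
    fun n => by
      rw [mem_preimage, mem_closedBall_zero_iff]
      exact ((InnerProductSpace.toDual ℝ _).norm_map (H n)).trans_le (hR n)
  obtain ⟨ℓ, -, hℓ⟩ := (WeakDual.isCompact_closedBall (0 : StrongDual ℝ (Lp ℝ 2 μ))
    R).ultrafilter_le_nhds ((hyperfilter ℕ).map D)
    (le_principal_iff.2 (Eventually.of_forall hDm : ∀ᶠ n in (hyperfilter ℕ : Filter ℕ), _))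
  obtain ⟨g, hg⟩ := (InnerProductSpace.toDual ℝ (Lp ℝ 2 μ)).surjective (WeakDual.toStrongDual ℓ)
  have key : ∀ ψ : Lp ℝ 2 μ,
      Tendsto (fun n => ∫ x, H n x * ψ x ∂μ) (hyperfilter ℕ : Filter ℕ) (𝓝 (∫ x, g x * ψ x ∂μ)) := by
    intro ψ
    have h1 : Tendsto (fun n => D n ψ) (hyperfilter ℕ : Filter ℕ) (𝓝 (ℓ ψ)) :=
      ((WeakDual.eval_continuous ψ).tendsto ℓ).comp hℓ
    have h2 : ∀ f : Lp ℝ 2 μ, InnerProductSpace.toDual ℝ (Lp ℝ 2 μ) f ψ = ∫ x, f x * ψ x ∂μ := by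
      intro f
      rw [InnerProductSpace.toDual_apply_apply, L2.inner_def]
      exact integral_congr_ae (ae_of_all _ fun x => by simp [mul_comm])
    have h3 : ℓ ψ = ∫ x, g x * ψ x ∂μ := by rw [← h2, hg]; rfl
    rw [← h3]
    exact h1.congr fun n => h2 (H n)
  have hgi : Integrable g μ := (Lp.memLp g).integrable one_le_two
  have hg0 : 0 ≤ᵐ[μ] g := by
    refine ae_nonneg_of_forall_setIntegral_nonneg hgi fun s hs hμs => ?_
    have e : ∀ f : Lp ℝ 2 μ, ∫ x, f x * (indicatorConstLp 2 hs hμs.ne (1 : ℝ)) x ∂μ =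
        ∫ x in s, f x ∂μ := by
      intro f
      rw [← L2.inner_indicatorConstLp_one hs hμs.ne f, L2.inner_def]
      exact integral_congr_ae (ae_of_all _ fun x => by simp)
    have := key (indicatorConstLp 2 hs hμs.ne (1 : ℝ))
    simp_rw [e] at this
    refine ge_of_tendsto' this fun n => setIntegral_nonneg_of_ae_restrict (ae_restrict_of_ae ?_)
    filter_upwards [(hm n).coeFn_toLp] with x hx
    exact hx.symm ▸ h0 n x
  have hKm := hK.isClosed.measurableSet
  refine ⟨K.indicator fun x => max (g x) 0, hyperfilter ℕ, inferInstance,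
    Nat.hyperfilter_le_atTop, (integrable_indicator_iff hKm).2 hgi.pos_part,
    indicator_nonneg fun x _ => le_max_right _ _, fun x hx => indicator_of_notMem hx _,
    fun ψ hψ => ?_⟩
  obtain ⟨C, hC⟩ := hK.exists_bound_of_continuousOn hψ.continuousOn
  have hψm : MemLp ψ 2 μ := MemLp.of_bound hψ.aestronglyMeasurable C
    ((ae_restrict_iff' hKm).2 (ae_of_all _ hC))
  have e1 : ∀ n, ∫ x, H n x * (hψm.toLp ψ) x ∂μ = ∫ x, h n x * ψ x := by
    intro n
    rw [← setIntegral_eq_integral_of_forall_compl_eq_zero (s := K) (μ := volume)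
      (f := fun x => h n x * ψ x) fun x hx => by rw [hs n x hx, zero_mul]]
    refine integral_congr_ae ?_
    filter_upwards [(hm n).coeFn_toLp, hψm.coeFn_toLp] with x h1 h2
    rw [h1, h2]
  have e2 : ∫ x, g x * (hψm.toLp ψ) x ∂μ = ∫ x, K.indicator (fun x => max (g x) 0) x * ψ x := by
    rw [← setIntegral_eq_integral_of_forall_compl_eq_zero (s := K) (μ := volume)
      (f := fun x => K.indicator (fun x => max (g x) 0) x * ψ x) fun x hx => by
        rw [indicator_of_notMem hx, zero_mul]]
    refine integral_congr_ae ?_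
    filter_upwards [hg0, hψm.coeFn_toLp, ae_restrict_mem hKm] with x h1 h2 h3
    rw [h2, indicator_of_mem h3, max_eq_left (show 0 ≤ g x from h1)]
  have := key (hψm.toLp ψ)
  rw [e2] at this
  exact this.congr e1

theorem continuous_integral_comp {N : ℕ} {κ : Measure (Eu N)} [IsFiniteMeasure κ]
    {G : Eu N → Eu N → ℝ} (hG : Continuous fun p : Eu N × Eu N => G p.1 p.2) {C : ℝ}
    (hC : ∀ x y, |G x y| ≤ C) : Continuous fun x => ∫ y, G x y ∂κ :=
  continuous_of_dominated (bound := fun _ => C)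
    (fun x => (hG.comp (by fun_prop : Continuous fun y : Eu N => (x, y))).aestronglyMeasurable)
    (fun x => ae_of_all _ (hC x)) (integrable_const C)
    (ae_of_all _ fun y => hG.comp (by fun_prop : Continuous fun x : Eu N => (x, y)))

theorem integral_smear_mul {N : ℕ} {κ : Measure (Eu N)} [IsFiniteMeasure κ] {m φ : Eu N → ℝ}
    (hm : Continuous m) (hmc : HasCompactSupport m) (hφ : Continuous φ)
    (hφc : HasCompactSupport φ) :
    ∫ x, (∫ y, m (x - y) ∂κ) * φ x = ∫ x, m x * ∫ y, φ (x + y) ∂κ := by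
  obtain ⟨C, hC⟩ := exists_abs_le_of_hasCompactSupport hm hmc
  obtain ⟨C', hC'⟩ := exists_abs_le_of_hasCompactSupport hφ hφc
  have i1 : Integrable (fun p : Eu N × Eu N => m (p.1 - p.2) * φ p.1) (volume.prod κ) := by
    refine ((hφ.integrable_of_hasCompactSupport hφc).mul_prod (integrable_const (1 : ℝ))).bdd_mul
      (f := fun p : Eu N × Eu N => m (p.1 - p.2)) (c := C) ?_ (ae_of_all _ fun p => hC _) |>.congr
      (ae_of_all _ fun p => by simp)
    exact (hm.comp (continuous_fst.sub continuous_snd)).aestronglyMeasurable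
  have i2 : Integrable (fun p : Eu N × Eu N => m p.1 * φ (p.1 + p.2)) (volume.prod κ) := by
    refine ((hm.integrable_of_hasCompactSupport hmc).mul_prod (integrable_const (1 : ℝ))).mul_bdd
      (g := fun p : Eu N × Eu N => φ (p.1 + p.2)) (c := C') ?_ (ae_of_all _ fun p => hC' _) |>.congr
      (ae_of_all _ fun p => by simp)
    exact (hφ.comp (continuous_fst.add continuous_snd)).aestronglyMeasurable
  simp_rw [← integral_mul_const, ← integral_const_mul]
  refine (integral_integral_swap i1).trans (Eq.trans ?_ (integral_integral_swap i2).symm)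
  congr 1
  funext y
  rw [← integral_add_right_eq_self (μ := volume) (fun x => m (x - y) * φ x) y]
  simp only [add_sub_cancel_right]

theorem moll_nonneg_of_ae {N : ℕ} (n : ℕ) {g : Eu N → ℝ} (hg : ∀ᵐ x, 0 ≤ g x) (x : Eu N) :
    0 ≤ moll n g x := by
  rw [moll_apply]
  exact integral_nonneg_of_ae (hg.mono fun y hy => mul_nonneg (mker_nonneg _ _ _) hy)

theorem hasCompactSupport_moll {N : ℕ} (n : ℕ) {g : Eu N → ℝ} (hg : HasCompactSupport g) :
    HasCompactSupport (moll n g) :=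
  (hasCompactSupport_mker N n).convolution _ hg

theorem IsTestFun.mul_left {N : ℕ} {Ω : Set (Eu N)} {χ φ : Eu N → ℝ} (h : IsTestFun Ω χ)
    (hφ : ContDiff ℝ ∞ φ) : IsTestFun Ω fun x => χ x * φ x :=
  ⟨h.1.mul hφ, h.2.1.mul_right, (tsupport_mul_subset_left).trans h.2.2⟩

/-- Smeared mollifications of the measure `χ (Δ w - f)`. -/
theorem exists_smear {N : ℕ} {Ω : Set (Eu N)} {w f χ : Eu N → ℝ} (h : LapGE Ω w f)
    (hw : ∀ᵐ x, x ∈ Ω → 0 ≤ w x) (hf : ∀ᵐ x, x ∈ Ω → 0 ≤ f x)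
    (hχ : IsTestFun Ω χ) (χ0 : ∀ x, 0 ≤ χ x) (hχ1 : ∀ x, (∫ z, radWt' N z) * χ x ≤ 1)
    {L ε M : ℝ} (hL : 0 ≤ L) (hε : 0 < ε)
    (hT : Metric.cthickening ε (Metric.cthickening (2 * ε) (tsupport χ)) ⊆ Ω)
    (hM : ∀ᵐ x, x ∈ Metric.cthickening ε (Metric.cthickening (2 * ε) (tsupport χ)) → w x ≤ M) :
    ∃ (m : ℕ → Eu N → ℝ) (B : ℝ), (∀ n, Continuous (m n)) ∧ (∀ n, HasCompactSupport (m n)) ∧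
      (∀ n x, 0 ≤ m n x) ∧ (∀ n x, x ∉ tsupport χ → m n x = 0) ∧
      (∀ ψ, ContDiff ℝ ∞ ψ → Tendsto (fun n => ∫ x, m n x * ψ x) atTop
        (𝓝 ((∫ x, w x * laplacian (fun x => χ x * ψ x) x) - ∫ x, f x * (χ x * ψ x)))) ∧
      ∀ n x, x ∈ Metric.cthickening ε (tsupport χ) → ∫ y, m n (x - y) ∂(radMeas N L ε) ≤ B := by
  set T := Metric.cthickening (2 * ε) (tsupport χ) with hTdef
  set K := Metric.cthickening ε T with hKdef
  have hTc : IsCompact T := hχ.2.1.isCompact.cthickening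
  have hKc : IsCompact K := hTc.cthickening
  have hKm : MeasurableSet K := hKc.isClosed.measurableSet
  have hχK : tsupport χ ⊆ K :=
    (Metric.self_subset_cthickening _).trans (Metric.self_subset_cthickening _)
  have iw : Integrable (K.indicator w) :=
    (integrable_indicator_iff hKm).2 (h.1.integrableOn_compact_subset hT hKc)
  have jf : Integrable (K.indicator f) :=
    (integrable_indicator_iff hKm).2 (h.2.1.integrableOn_compact_subset hT hKc)
  have hcs : HasCompactSupport (K.indicator w) :=
    HasCompactSupport.intro hKc fun x hx => indicator_of_notMem hx _
  have w0 : ∀ᵐ x, 0 ≤ K.indicator w x := hw.mono fun x hx => by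
    by_cases hxK : x ∈ K
    · simpa [hxK] using hx (hT hxK)
    · simp [hxK]
  have f0 : ∀ᵐ x, 0 ≤ K.indicator f x := hf.mono fun x hx => by
    by_cases hxK : x ∈ K
    · simpa [hxK] using hx (hT hxK)
    · simp [hxK]
  have wM : ∀ᵐ x, K.indicator w x ≤ |M| := hM.mono fun x hx => by
    by_cases hxK : x ∈ K
    · simpa [hxK] using (hx hxK).trans (le_abs_self M)
    · simp [hxK]
  set C := ∫ z, radWt' N z with hC
  have C0 : 0 < C := integral_radWt'_pos N
  obtain ⟨n₀, hn₀⟩ := eventually_atTop.1 (eventually_moll_le h hε hTc hT)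
  set W : ℕ → Eu N → ℝ := fun n => moll (n + n₀) (K.indicator w) with hW
  set G : ℕ → Eu N → ℝ := fun n => moll (n + n₀) (K.indicator f) with hG
  have cW : ∀ n, ContDiff ℝ ∞ (W n) := fun n => contDiff_moll _ iw
  have cG : ∀ n, ContDiff ℝ ∞ (G n) := fun n => contDiff_moll _ jf
  have sW : ∀ n, HasCompactSupport (W n) := fun n => hasCompactSupport_moll _ hcs
  have G0 : ∀ n x, 0 ≤ G n x := fun n x => moll_nonneg_of_ae _ f0 x
  have hWG : ∀ n, ∀ x ∈ T, G n x ≤ laplacian (W n) x := fun n => hn₀ (n + n₀) (Nat.le_add_left _ _)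
  refine ⟨fun n x => χ x * (laplacian (W n) x - G n x),
    C⁻¹ * (C * (2 + L / 2 * ε ^ 2) * |M|), fun n => ?_, fun n => hχ.2.1.mul_right,
    fun n x => ?_, fun n x hx => ?_, fun ψ hψ => ?_, fun n x hx => ?_⟩
  · exact hχ.1.continuous.mul ((cW n).laplacian.continuous.sub (cG n).continuous)
  · beta_reduce
    by_cases hx : x ∈ tsupport χ
    · exact mul_nonneg (χ0 x) (sub_nonneg.2 (hWG n x (Metric.self_subset_cthickening _ hx)))
    · rw [image_eq_zero_of_notMem_tsupport hx, zero_mul]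
  · beta_reduce
    rw [image_eq_zero_of_notMem_tsupport hx, zero_mul]
  · have hχψ := hχ.mul_left hψ
    have hs : tsupport (fun x => χ x * ψ x) ⊆ K := (tsupport_mul_subset_left).trans hχK
    have cψ := hχψ.1.continuous
    have cΔ := hχψ.1.laplacian.continuous
    have sΔ := hχψ.2.1.laplacian hχψ.1
    obtain ⟨C₁, hC₁⟩ := exists_abs_le_of_hasCompactSupport cψ hχψ.2.1
    obtain ⟨C₂, hC₂⟩ := exists_abs_le_of_hasCompactSupport cΔ sΔ
    have t1 := tendsto_integral_mul_of_L1 (fun n => integrable_moll n iw) iw (moll_L1_tendsto iw)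
      (fun _ => cΔ.aestronglyMeasurable) (fun _ => hC₂) (ae_of_all _ fun x => tendsto_const_nhds)
    have t2 := tendsto_integral_mul_of_L1 (fun n => integrable_moll n jf) jf (moll_L1_tendsto jf)
      (fun _ => cψ.aestronglyMeasurable) (fun _ => hC₁) (ae_of_all _ fun x => tendsto_const_nhds)
    have e1 : ∀ (g k : Eu N → ℝ), tsupport k ⊆ K → ∫ x, K.indicator g x * k x = ∫ x, g x * k x :=
      fun g k hk => by
        refine integral_congr_ae (ae_of_all _ fun x => ?_)
        by_cases hx : x ∈ K
        · simp [hx]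
        · simp [image_eq_zero_of_notMem_tsupport fun h => hx (hk h)]
    have t3 := (tendsto_add_atTop_iff_nat n₀).2 (t1.sub t2)
    rw [e1 _ _ ((tsupport_laplacian_subset hχψ.1).trans hs), e1 _ _ hs] at t3
    refine t3.congr fun n => ?_
    rw [integral_mul_laplacian (cW n) hχψ.1 hχψ.2.1, ← integral_sub]
    · exact integral_congr_ae (ae_of_all _ fun x => by simp only [hW, hG]; ring)
    · exact ((cW n).laplacian.continuous.mul cψ).integrable_of_hasCompactSupport
        hχψ.2.1.mul_left
    · exact ((cG n).continuous.mul cψ).integrable_of_hasCompactSupport hχψ.2.1.mul_left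
  · have hs : ContDiff ℝ ∞ fun y : Eu N => W n (0 - y) := (cW n).comp (contDiff_const.sub contDiff_id)
    have hsc : HasCompactSupport fun y : Eu N => W n (0 - y) :=
      (sW n).comp_homeomorph (Homeomorph.subLeft 0)
    have b1 := integral_laplacian_radMeas_le hs hsc (M := |M|) (fun y => by
      rw [abs_of_nonneg (moll_nonneg_of_ae _ w0 _)]; exact moll_le _ iw wM _) hL hε.le (-x)
    refine le_trans ?_ (mul_le_mul_of_nonneg_left b1 (inv_nonneg.2 C0.le))
    rw [← integral_const_mul]
    have hb : ∀ {g : Eu N → ℝ}, Continuous g → HasCompactSupport g →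
        Integrable (fun y => g (x - y)) (radMeas N L ε) := fun {g} hg hgc => by
      obtain ⟨C', hC'⟩ := exists_abs_le_of_hasCompactSupport hg hgc
      exact Integrable.of_bound
        (hg.comp (continuous_const.sub continuous_id)).aestronglyMeasurable C'
        (ae_of_all _ fun y => hC' _)
    have e : ∀ y, laplacian (fun y => W n (0 - y)) (-x + y) = laplacian (W n) (x - y) := fun y => by
      rw [laplacian_comp_sub (cW n)]; congr 1; abel
    simp_rw [e]
    refine integral_mono_ae (hb (hχ.1.continuous.mul
        ((cW n).laplacian.continuous.sub (cG n).continuous)) hχ.2.1.mul_right)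
      ((hb (cW n).laplacian.continuous ((sW n).laplacian (cW n))).const_mul _) ?_
    filter_upwards [ae_norm_le_radMeas N L ε] with y hy
    have hxy : x - y ∈ T := by
      have : x - y ∈ Metric.cthickening ε (Metric.cthickening ε (tsupport χ)) :=
        Metric.mem_cthickening_of_dist_le (x - y) x ε _ hx (by simpa [dist_eq_norm] using hy)
      have := Metric.cthickening_cthickening_subset hε.le hε.le _ this
      rwa [← two_mul] at this
    have h1 := hWG n _ hxy
    have h2 := G0 n (x - y)
    have h3 : χ (x - y) ≤ C⁻¹ := by
      rw [← one_div, le_div_iff₀ C0, mul_comm]; exact hχ1 _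
    have h4 := χ0 (x - y)
    have h5 : 0 ≤ C⁻¹ := inv_nonneg.2 C0.le
    nlinarith

theorem norm_sub_le_of_notMem_cthickening {N : ℕ} {K : Set (Eu N)} {ε : ℝ} {x y : Eu N}
    (hx : x ∉ Metric.cthickening ε K) (hy : ‖y‖ ≤ ε) : x - y ∉ K := fun h =>
  hx (Metric.mem_cthickening_of_dist_le x (x - y) ε K h (by simpa [dist_eq_norm] using hy))

/-- If `Δ w - f` is a nonzero positive distribution, part of it can be smeared out, giving a
nontrivial nonnegative `h` with compact support and `Δ (w + h) ≥ f + L h`. -/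
theorem LapGE.exists_correction {N : ℕ} {Ω : Set (Eu N)} {w f χ : Eu N → ℝ} (hΩ : IsOpen Ω)
    (h : LapGE Ω w f)
    (hw : ∀ᵐ x, x ∈ Ω → 0 ≤ w x) (hf : ∀ᵐ x, x ∈ Ω → 0 ≤ f x)
    (hχ : IsTestFun Ω χ) (χ0 : ∀ x, 0 ≤ χ x) (hχ1 : ∀ x, (∫ z, radWt' N z) * χ x ≤ 1)
    (hpos : ∫ x, f x * χ x < ∫ x, w x * laplacian χ x)
    {L ε M : ℝ} (hL : 0 ≤ L) (hε : 0 < ε)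
    (hT : Metric.cthickening ε (Metric.cthickening (2 * ε) (tsupport χ)) ⊆ Ω)
    (hM : ∀ᵐ x, x ∈ Metric.cthickening ε (Metric.cthickening (2 * ε) (tsupport χ)) → w x ≤ M) :
    ∃ g : Eu N → ℝ, Integrable g ∧ (∀ x, 0 ≤ g x) ∧
      (∀ x, x ∉ Metric.cthickening ε (tsupport χ) → g x = 0) ∧
      (¬ ∀ᵐ x, g x = 0) ∧ LapGE Ω (fun x => w x + g x) (fun x => f x + L * g x) := by
  obtain ⟨m, B, cm, sm, m0, mχ, hm, hmB⟩ := exists_smear h hw hf hχ χ0 hχ1 hL hε hT hM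
  set κ := radMeas N L ε with hκ
  set K := Metric.cthickening ε (tsupport χ) with hK
  have hKc : IsCompact K := hχ.2.1.isCompact.cthickening
  have hKΩ : K ⊆ Ω := by
    refine Subset.trans ?_ ((Metric.self_subset_cthickening _).trans hT)
    exact Metric.cthickening_mono (by linarith) _
  have hκε : ∀ᵐ y ∂κ, ‖y‖ ≤ ε := ae_norm_le_radMeas N L ε
  set k : ℕ → Eu N → ℝ := fun n x => ∫ y, m n (x - y) ∂κ with hk
  have ck : ∀ n, Continuous (k n) := fun n => by
    obtain ⟨C, hC⟩ := exists_abs_le_of_hasCompactSupport (cm n) (sm n)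
    exact continuous_integral_comp (G := fun x y => m n (x - y))
      ((cm n).comp (continuous_fst.sub continuous_snd)) fun x y => hC _
  have k0 : ∀ n x, 0 ≤ k n x := fun n x => integral_nonneg fun y => m0 n _
  have kK : ∀ n x, x ∉ K → k n x = 0 := fun n x hx => by
    refine integral_eq_zero_of_ae ?_
    filter_upwards [hκε] with y hy
    exact mχ n _ (norm_sub_le_of_notMem_cthickening hx hy)
  have kB : ∀ n x, k n x ≤ B ⊔ 0 := fun n x => by
    by_cases hx : x ∈ K
    · exact (hmB n x hx).trans (le_max_left _ _)
    · exact (kK n x hx).trans_le (le_max_right _ _)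
  obtain ⟨g, F, hF, hFat, ig, g0, gK, hg⟩ := exists_weak_limit hKc ck k0 kB kK
  have lg : LocallyIntegrableOn g Ω := ig.locallyIntegrable.locallyIntegrableOn Ω
  have lL : LocallyIntegrableOn (fun x => L * g x) Ω :=
    (ig.const_mul L).locallyIntegrable.locallyIntegrableOn Ω
  refine ⟨g, ig, g0, gK, fun hgz => ?_, h.1.add lg, h.2.1.add lL, fun φ hφ φ0 => ?_⟩
  · obtain ⟨η, hη, η0, η1⟩ := exists_cutoff hΩ hKc hKΩ
    have t1 := hg η hη.1.continuous
    have t2 : Tendsto (fun n => ∫ x, k n x * η x) F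
        (𝓝 (((∫ x, w x * laplacian χ x) - ∫ x, f x * χ x) * κ.real univ)) := by
      have := ((hm (fun _ => 1) contDiff_const).mul_const (κ.real univ)).mono_left hFat
      simp only [mul_one] at this
      refine this.congr fun n => ?_
      simp only [hk]
      rw [integral_smear_mul (cm n) (sm n) hη.1.continuous hη.2.1, ← integral_mul_const]
      refine integral_congr_ae (ae_of_all _ fun x => ?_)
      by_cases hx : x ∈ tsupport χ
      · have : ∫ y, η (x + y) ∂κ = κ.real univ := by
          rw [← mul_one (κ.real univ), ← smul_eq_mul, ← integral_const]
          refine integral_congr_ae ?_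
          filter_upwards [hκε] with y hy
          refine (η1 (x + y) ?_).eq_of_nhds
          exact Metric.mem_cthickening_of_dist_le (x + y) x ε _ hx (by simpa [dist_eq_norm] using hy)
        simp only [this]
      · simp only [mχ n x hx, zero_mul]
    have e := tendsto_nhds_unique t1 t2
    rw [integral_eq_zero_of_ae (hgz.mono fun x hx => by simp [hx])] at e
    exact absurd e (mul_pos (sub_pos.2 hpos) (radMeas_univ_pos N L hε)).ne
  · set C := ∫ z, radWt' N z with hC
    have cφ := hφ.1.continuous
    have cΔ := hφ.1.laplacian.continuous
    have sΔ := hφ.2.1.laplacian hφ.1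
    have step : (-C) * ((∫ x, w x * laplacian (fun x => χ x * φ x) x) - ∫ x, f x * (χ x * φ x)) +
        L * ∫ x, g x * φ x ≤ ∫ x, g x * laplacian φ x := by
      refine le_of_tendsto_of_tendsto' ((((hm φ hφ.1).mono_left hFat).const_mul (-C)).add
        ((hg φ cφ).const_mul L)) (hg _ cΔ) fun n => ?_
      obtain ⟨C₁, hC₁⟩ := exists_abs_le_of_hasCompactSupport cφ hφ.2.1
      obtain ⟨C₂, hC₂⟩ := exists_abs_le_of_hasCompactSupport cΔ sΔ
      have c1 : Continuous fun x => ∫ y, φ (x + y) ∂κ :=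
        continuous_integral_comp (G := fun x y => φ (x + y))
          (cφ.comp (continuous_fst.add continuous_snd)) fun x y => hC₁ _
      have c2 : Continuous fun x => ∫ y, laplacian φ (x + y) ∂κ :=
        continuous_integral_comp (G := fun x y => laplacian φ (x + y))
          (cΔ.comp (continuous_fst.add continuous_snd)) fun x y => hC₂ _
      have j : ∀ {r : Eu N → ℝ}, Continuous r → Integrable fun x => m n x * r x := fun hr =>
        ((cm n).mul hr).integrable_of_hasCompactSupport (sm n).mul_right
      simp only [hk]
      rw [integral_smear_mul (cm n) (sm n) cφ hφ.2.1, integral_smear_mul (cm n) (sm n) cΔ sΔ,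
        ← integral_const_mul, ← integral_const_mul, ← integral_add ((j cφ).const_mul _)
          ((j c1).const_mul _)]
      refine integral_mono (((j cφ).const_mul _).add ((j c1).const_mul _)) (j c2) fun x => ?_
      have := mul_le_mul_of_nonneg_left
        (le_integral_laplacian_radMeas hφ.1 hφ.2.1 φ0 hL hε.le x) (m0 n x)
      simp only
      rw [← hC, ← hκ] at this
      linarith
    have hχφ := hχ.mul_left hφ.1
    have hψ : IsTestFun Ω fun x => φ x - C * (χ x * φ x) := by
      have := hφ.mul_left (φ := fun x => 1 - C * χ x) (contDiff_const.sub (contDiff_const.mul hχ.1))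
      have e : (fun x => φ x - C * (χ x * φ x)) = fun x => φ x * (1 - C * χ x) := by
        funext x; ring
      rwa [e]
    have pos := h.2.2 _ hψ fun x => by
      have := mul_nonneg (φ0 x) (sub_nonneg.2 (hχ1 x))
      linarith
    have e1 : ∫ x, f x * (φ x - C * (χ x * φ x)) =
        (∫ x, f x * φ x) - C * ∫ x, f x * (χ x * φ x) := by
      rw [← integral_const_mul, ← integral_sub (hφ.integrable_mul h.2.1)
        ((hχφ.integrable_mul h.2.1).const_mul C)]
      exact integral_congr_ae (ae_of_all _ fun x => by ring)
    have e2 : ∫ x, w x * laplacian (fun x => φ x - C * (χ x * φ x)) x =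
        (∫ x, w x * laplacian φ x) - C * ∫ x, w x * laplacian (fun x => χ x * φ x) x := by
      rw [← integral_const_mul, ← integral_sub (hφ.integrable_mul_laplacian h.1)
        ((hχφ.integrable_mul_laplacian h.1).const_mul C)]
      refine integral_congr_ae (ae_of_all _ fun x => ?_)
      simp only
      rw [laplacian_sub hφ.1 (contDiff_const.mul hχφ.1), laplacian_const_mul hχφ.1]
      ring
    have e3 : ∫ x, (f x + L * g x) * φ x = (∫ x, f x * φ x) + L * ∫ x, g x * φ x := by
      rw [← integral_const_mul, ← integral_add (hφ.integrable_mul h.2.1)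
        ((hφ.integrable_mul lg).const_mul L)]
      exact integral_congr_ae (ae_of_all _ fun x => by ring)
    have e4 : ∫ x, (w x + g x) * laplacian φ x =
        (∫ x, w x * laplacian φ x) + ∫ x, g x * laplacian φ x := by
      rw [← integral_add (hφ.integrable_mul_laplacian h.1) (hφ.integrable_mul_laplacian lg)]
      exact integral_congr_ae (ae_of_all _ fun x => by ring)
    rw [e1, e2] at pos
    rw [e3, e4]
    linarith

theorem nl_sub_le {q s t M : ℝ} (hq : 1 < q) (hs : 0 ≤ s) (hst : s ≤ t) (htM : t ≤ M) :
    nl q t - nl q s ≤ q * M ^ (q - 1) * (t - s) := by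
  rcases (hs.trans hst).eq_or_lt with rfl | ht
  · rw [le_antisymm hst hs]; simp
  rw [nl_of_nonneg hq hs, nl_of_nonneg hq ht.le]
  have h1 := one_add_mul_self_le_rpow_one_add (s := s / t - 1)
    (by linarith [div_nonneg hs ht.le]) hq.le
  rw [add_sub_cancel, Real.div_rpow hs ht.le, le_div_iff₀ (Real.rpow_pos_of_pos ht q)] at h1
  have h2 : t ^ q = t ^ (q - 1) * t := by
    rw [← Real.rpow_add_one ht.ne', sub_add_cancel]
  have h3 : (1 + q * (s / t - 1)) * t ^ q = t ^ q - q * t ^ (q - 1) * (t - s) := by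
    rw [h2]; field_simp; ring
  have h4 : t ^ (q - 1) ≤ M ^ (q - 1) := Real.rpow_le_rpow ht.le htM (by linarith)
  have h5 : q * t ^ (q - 1) * (t - s) ≤ q * M ^ (q - 1) * (t - s) :=
    mul_le_mul_of_nonneg_right (mul_le_mul_of_nonneg_left h4 (by linarith)) (sub_nonneg.2 hst)
  linarith

theorem maxWt_nonneg (t : ℝ) : 0 ≤ maxWt t := by
  rcases lt_trichotomy t 0 with h | rfl | h
  · rw [maxWt_of_neg h]
  · rw [maxWt_zero]; norm_num
  · rw [maxWt_of_pos h]; norm_num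

theorem LapGE.mono {N : ℕ} {Ω : Set (Eu N)} {v f f' : Eu N → ℝ} (h : LapGE Ω v f)
    (hf' : LocallyIntegrableOn f' Ω) (hle : ∀ᵐ x, x ∈ Ω → f' x ≤ f x) : LapGE Ω v f' := by
  refine ⟨h.1, hf', fun φ hφ φ0 => le_trans ?_ (h.2.2 φ hφ φ0)⟩
  refine integral_mono_ae (hφ.integrable_mul hf') (hφ.integrable_mul h.2.1) ?_
  filter_upwards [hle] with x hx
  by_cases hxΩ : x ∈ Ω
  · exact mul_le_mul_of_nonneg_right (hx hxΩ) (φ0 x)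
  · simp [image_eq_zero_of_notMem_tsupport fun h => hxΩ (hφ.2.2 h)]

/-- The maximal nonnegative subsolution below `u` has no defect measure. -/
theorem SubBelow.not_lt_of_maximal {N : ℕ} (hN : 0 < N) {q : ℝ} (hq : 1 < q) {Ω : Set (Eu N)}
    (hΩ : IsOpen Ω) {u w χ : Eu N → ℝ} (hu : IsSupersolution q Ω u) (hub : MemLinftyLoc Ω u)
    (hw : SubBelow q Ω u w) (hmax : ∀ v, SubBelow q Ω u v → ∀ᵐ x, x ∈ Ω → v x ≤ w x)
    (hχ : IsTestFun Ω χ) (χ0 : ∀ x, 0 ≤ χ x) (hχ1 : ∀ x, (∫ z, radWt' N z) * χ x ≤ 1) :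
    ¬ ∫ x, nl q (w x) * χ x < ∫ x, w x * laplacian χ x := by
  intro hpos
  obtain ⟨δ, hδ, hδΩ⟩ := hχ.2.1.isCompact.exists_cthickening_subset_open hΩ hχ.2.2
  set ε := δ / 3 with hεdef
  have hε : 0 < ε := by positivity
  set T := Metric.cthickening ε (Metric.cthickening (2 * ε) (tsupport χ)) with hTdef
  have hT : T ⊆ Ω := by
    refine (Metric.cthickening_cthickening_subset hε.le (by linarith) _).trans ?_
    rwa [show ε + 2 * ε = δ by rw [hεdef]; ring]
  have hTc : IsCompact T := hχ.2.1.isCompact.cthickening.cthickening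
  obtain ⟨M₀, hM₀⟩ := hub.2 T hT hTc
  have hM : ∀ᵐ x, x ∈ T → u x ≤ |M₀| := by
    filter_upwards [(ae_restrict_iff' hTc.isClosed.measurableSet).1 hM₀] with x hx hxT
    exact (le_abs_self _).trans ((hx hxT).trans (le_abs_self _))
  set M := |M₀| with hMdef
  set L := q * M ^ (q - 1) with hLdef
  have hL : 0 ≤ L := mul_nonneg (by linarith) (Real.rpow_nonneg (abs_nonneg _) _)
  have hwM : ∀ᵐ x, x ∈ T → w x ≤ M := by
    filter_upwards [hM, hw.2.2] with x h1 h2 hx using (h2 (hT hx)).trans (h1 hx)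
  obtain ⟨g, ig, g0, gK, gne, hg⟩ := hw.1.exists_correction hΩ hw.2.1
    (hw.2.1.mono fun x hx hxΩ => nl_nonneg hq (hx hxΩ)) hχ χ0 hχ1 hpos hL hε hT hwM
  set K := Metric.cthickening ε (tsupport χ) with hKdef
  have hKc : IsCompact K := hχ.2.1.isCompact.cthickening
  have hKT : K ⊆ T := (Metric.cthickening_mono (by linarith) _).trans
    (Metric.self_subset_cthickening _)
  have hvu : ∀ᵐ x, x ∈ Ω → w x + g x ≤ u x := by
    have hd := (hg.add (hu.lapGE hq hΩ)).max hΩ (lapGE_zero Ω)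
    have hz := hd.ae_eq_zero hN hΩ hKc (hKT.trans hT) ?_ (ae_of_all _ fun _ _ => le_max_right _ _) ?_
    · filter_upwards [hz] with x hx hxΩ
      have := max_eq_right_iff.1 (hx hxΩ)
      linarith
    · filter_upwards [hM, hw.2.1, hw.2.2] with x h1 h2 h3 hxΩ
      rw [zero_mul, add_zero, sub_zero]
      rcases lt_or_ge (w x + g x + -u x) 0 with h | h
      · rw [maxWt_of_neg h, mul_zero]
      · refine mul_nonneg ?_ (maxWt_nonneg _)
        by_cases hx : x ∈ K
        · have h4 := nl_sub_le hq (h2 hxΩ) (h3 hxΩ) (h1 (hKT hx))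
          have h5 := mul_le_mul_of_nonneg_left (show u x - w x ≤ g x by linarith) hL
          linarith
        · rw [gK x hx] at h ⊢
          rw [le_antisymm (h3 hxΩ) (by linarith)]
          simp
    · filter_upwards [hw.2.2] with x h3 hxΩ hxK
      rw [gK x hxK]
      exact max_eq_right (by linarith [h3 hxΩ])
  have hv : SubBelow q Ω u fun x => w x + g x := by
    refine ⟨hg.mono ?_ ?_, ?_, hvu⟩
    · refine locallyIntegrableOn_of_abs_le hΩ
        ((continuous_nl hq).comp_aestronglyMeasurable hg.1.aestronglyMeasurable)
        (hu.1.locallyIntegrableOn hq hΩ).2 ?_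
      filter_upwards [hvu, hw.2.1] with x h1 h2 hxΩ
      have h3 : 0 ≤ w x + g x := add_nonneg (h2 hxΩ) (g0 x)
      rw [abs_of_nonneg (nl_nonneg hq h3)]
      exact nl_le_nl hq h3 (h1 hxΩ)
    · filter_upwards [hvu, hw.2.1, hM] with x h1 h2 h3 hxΩ
      by_cases hx : x ∈ K
      · have := nl_sub_le hq (h2 hxΩ) (le_add_of_nonneg_right (g0 x))
          ((h1 hxΩ).trans (h3 (hKT hx)))
        rw [add_sub_cancel_left] at this
        linarith
      · simp [gK x hx]
    · filter_upwards [hw.2.1] with x h2 hxΩ using add_nonneg (h2 hxΩ) (g0 x)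
  refine gne ?_
  filter_upwards [hmax _ hv] with x hx
  by_cases hxΩ : x ∈ Ω
  · exact le_antisymm (by linarith [hx hxΩ]) (g0 x)
  · exact gK x fun h => hxΩ (hT (hKT h))

theorem IsTestFun.const_mul {N : ℕ} {Ω : Set (Eu N)} {φ : Eu N → ℝ} (h : IsTestFun Ω φ) (c : ℝ) :
    IsTestFun Ω fun x => c * φ x :=
  ⟨contDiff_const.mul h.1, h.2.1.mul_left, (tsupport_mul_subset_right).trans h.2.2⟩

theorem IsTestFun.add {N : ℕ} {Ω : Set (Eu N)} {φ ψ : Eu N → ℝ} (h : IsTestFun Ω φ)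
    (h' : IsTestFun Ω ψ) : IsTestFun Ω fun x => φ x + ψ x :=
  ⟨h.1.add h'.1, h.2.1.add h'.2.1, (tsupport_add φ ψ).trans (union_subset h.2.2 h'.2.2)⟩

theorem SubBelow.weak_eq_of_maximal {N : ℕ} (hN : 0 < N) {q : ℝ} (hq : 1 < q) {Ω : Set (Eu N)}
    (hΩ : IsOpen Ω) {u w φ : Eu N → ℝ} (hu : IsSupersolution q Ω u) (hub : MemLinftyLoc Ω u)
    (hw : SubBelow q Ω u w) (hmax : ∀ v, SubBelow q Ω u v → ∀ᵐ x, x ∈ Ω → v x ≤ w x)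
    (hφ : IsTestFun Ω φ) : ∫ x, nl q (w x) * φ x = ∫ x, w x * laplacian φ x := by
  have hl : ∀ {χ : Eu N → ℝ}, IsTestFun Ω χ → ∀ c : ℝ,
      (∫ x, nl q (w x) * (c * χ x) = c * ∫ x, nl q (w x) * χ x) ∧
      ∫ x, w x * laplacian (fun x => c * χ x) x = c * ∫ x, w x * laplacian χ x := by
    intro χ hχ c
    constructor
    · rw [← integral_const_mul]
      exact integral_congr_ae (ae_of_all _ fun x => by ring)
    · rw [← integral_const_mul]
      refine integral_congr_ae (ae_of_all _ fun x => ?_)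
      simp only
      rw [laplacian_const_mul hχ.1]; ring
  have key : ∀ χ, IsTestFun Ω χ → (∀ x, 0 ≤ χ x) →
      ∫ x, nl q (w x) * χ x = ∫ x, w x * laplacian χ x := by
    intro χ hχ χ0
    refine le_antisymm (hw.1.2.2 χ hχ χ0) ?_
    obtain ⟨B, hB⟩ := exists_abs_le_of_hasCompactSupport hχ.1.continuous hχ.2.1
    have hB0 : 0 ≤ B := (abs_nonneg _).trans (hB 0)
    set C := ∫ z, radWt' N z with hC
    have C0 : 0 < C := integral_radWt'_pos N
    set c := (C * (B + 1))⁻¹ with hc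
    have c0 : 0 < c := by positivity
    have := SubBelow.not_lt_of_maximal hN hq hΩ hu hub hw hmax (hχ.const_mul c)
      (fun x => mul_nonneg c0.le (χ0 x)) fun x => by
        have : C * (c * χ x) = χ x / (B + 1) := by rw [hc]; field_simp
        rw [← hC, this, div_le_one (by linarith)]
        linarith [(le_abs_self _).trans (hB x)]
    rw [(hl hχ c).1, (hl hχ c).2] at this
    exact le_of_mul_le_mul_left (not_lt.1 this) c0
  obtain ⟨B, hB⟩ := exists_abs_le_of_hasCompactSupport hφ.1.continuous hφ.2.1
  obtain ⟨η, hη, η0, η1⟩ := exists_cutoff hΩ hφ.2.1 hφ.2.2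
  have hB0 : 0 ≤ B := (abs_nonneg _).trans (hB 0)
  have h1 := key η hη η0
  have h2 := key _ ((hη.const_mul B).add hφ) fun x => by
    by_cases hx : x ∈ tsupport φ
    · rw [(η1 x hx).eq_of_nhds]
      linarith [neg_le_of_abs_le (hB x)]
    · rw [image_eq_zero_of_notMem_tsupport hx, add_zero]
      exact mul_nonneg hB0 (η0 x)
  have e1 : ∫ x, nl q (w x) * (B * η x + φ x) =
      B * (∫ x, nl q (w x) * η x) + ∫ x, nl q (w x) * φ x := by
    rw [← (hl hη B).1, ← integral_add ((hη.const_mul B).integrable_mul hw.1.2.1)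
      (hφ.integrable_mul hw.1.2.1)]
    exact integral_congr_ae (ae_of_all _ fun x => by ring)
  have e2 : ∫ x, w x * laplacian (fun x => B * η x + φ x) x =
      B * (∫ x, w x * laplacian η x) + ∫ x, w x * laplacian φ x := by
    rw [← (hl hη B).2, ← integral_add ((hη.const_mul B).integrable_mul_laplacian hw.1.1)
      (hφ.integrable_mul_laplacian hw.1.1)]
    refine integral_congr_ae (ae_of_all _ fun x => ?_)
    simp only
    rw [laplacian_add (hη.const_mul B).1 hφ.1]; ring
  rw [e1, e2, h1] at h2
  exact add_left_cancel h2

theorem stmt3 {N : ℕ} (hN : 2 ≤ N) (q : ℝ) (hq : ((N : ℝ) + 1) / ((N : ℝ) - 1) ≤ q)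
    (Ω : Set (EuclideanSpace ℝ (Fin N))) (hΩ : IsOpen Ω) (hΩne : Ω.Nonempty)
    (hΩbd : Bornology.IsBounded Ω)
    (u : EuclideanSpace ℝ (Fin N) → ℝ) (huloc : MemLinftyLoc Ω u)
    (hpos : ∀ᵐ x ∂(volume.restrict Ω), 0 ≤ u x)
    (hsup : IsSupersolution q Ω u) :
    ∃ w : EuclideanSpace ℝ (Fin N) → ℝ, IsSolution q Ω w ∧
      (∀ᵐ x ∂(volume.restrict Ω), w x ≤ u x) ∧
      ∀ V : EuclideanSpace ℝ (Fin N) → ℝ, IsSolution q Ω V →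
        (∀ᵐ x ∂(volume.restrict Ω), V x ≤ u x) →
        (∀ᵐ x ∂(volume.restrict Ω), V x ≤ w x) := by
  have hN1 : (0 : ℝ) < (N : ℝ) - 1 := by
    have : (2 : ℝ) ≤ N := by exact_mod_cast hN
    linarith
  have hq1 : 1 < q := lt_of_lt_of_le (by rw [lt_div_iff₀ hN1]; linarith) hq
  rw [ae_restrict_iff_of_isOpen hΩ] at hpos
  obtain ⟨hu, hu'⟩ := hsup.1.locallyIntegrableOn hq1 hΩ
  obtain ⟨w, hw, hmax⟩ := exists_maximal_subBelow hq1 hΩ hΩbd hu hu' hpos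
  have hwm : AEStronglyMeasurable w (volume.restrict Ω) := hw.1.1.aestronglyMeasurable
  have hwq : MemLqLoc q Ω w := by
    refine ⟨hwm, fun K hK hKc => ?_⟩
    have hm : AEStronglyMeasurable (fun x => |w x| ^ q) (volume.restrict K) :=
      ((continuous_abs.rpow_const fun _ => Or.inr (by linarith)).comp_aestronglyMeasurable
        hwm).mono_measure (Measure.restrict_mono hK le_rfl)
    refine (hsup.1.2 K hK hKc).mono' hm ?_
    rw [ae_restrict_iff' hKc.isClosed.measurableSet]
    filter_upwards [hw.2.1, hw.2.2] with x h1 h2 hxK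
    rw [Real.norm_of_nonneg (Real.rpow_nonneg (abs_nonneg _) _)]
    refine Real.rpow_le_rpow (abs_nonneg _) ?_ (by linarith)
    rw [abs_of_nonneg (h1 (hK hxK))]
    exact (h2 (hK hxK)).trans (le_abs_self _)
  refine ⟨w, ⟨hwq, fun φ hφ => ?_⟩, (ae_restrict_iff_of_isOpen hΩ).2 hw.2.2, fun V hV hVu => ?_⟩
  · rw [setIntegral_weak_eq hq1 hΩ hwq hφ,
      hw.weak_eq_of_maximal (by linarith) hq1 hΩ hsup huloc hmax hφ, sub_self]
  · rw [ae_restrict_iff_of_isOpen hΩ] at hVu ⊢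
    filter_upwards [hmax _ (hV.subBelow hq1 hΩ hpos hVu)] with x hx hxΩ
    exact (le_max_left _ _).trans (hx hxΩ)
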